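/- arXiv:1602.07323 — 2 statements merged into one kernel-verified Lean document; each statement's English description precedes it below -/
import Mathlib

section
/- Let (Ω, F, P) be a probability space, D an arbitrary index set, X : D → (Ω → ℝ) a family of random variables and Y : Ω → ℝ a random variable such that for every finite collection x_1, …, x_n ∈ D the random vector (Y, X(x_1), …, X(x_n)) is a centered Gaussian vector. Then for every bounded function F : (D → ℝ) → ℝ that is measurable with respect to the product σ-algebra, E[ e^{Y − E[Y²]/2} · F((X(x))_{x∈D}) ] = E[ F((X(x) + E[Y·X(x)])_{x∈D}) ] (Girsanov/Cameron–Martin shift: under the tilted measure e^{Y − E[Y²]/2} dP the field X(x) has the law of X(x) + E[Y·X(x)] under P). -/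
open MeasureTheory ProbabilityTheory
open scoped NNReal

namespace ProbabilityTheory

variable {Ω Ω' : Type*} {mΩ : MeasurableSpace Ω} {mΩ' : MeasurableSpace Ω'}

/-- Two random variables with the same everywhere finite moment-generating function have the
same law. -/
lemma map_eq_map_of_mgf_eq {P : Measure Ω} {Q : Measure Ω'} [IsProbabilityMeasure P]
    [IsProbabilityMeasure Q] {X : Ω → ℝ} {Y : Ω' → ℝ} (hX : AEMeasurable X P)
    (hY : AEMeasurable Y Q) (hint : ∀ t : ℝ, Integrable (fun ω => Real.exp (t * X ω)) P)
    (h : mgf X P = mgf Y Q) : P.map X = Q.map Y := by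
  refine Measure.ext_of_complexMGF_eq hX hY (funext fun z => eqOn_complexMGF_of_mgf h ?_)
  have huniv : integrableExpSet X P = Set.univ := Set.eq_univ_of_forall hint
  simp [huniv]

section CenteredGaussian

variable {P : Measure Ω} {Z : Ω → ℝ} {v : ℝ≥0}

lemma memLp_two_of_map_eq_gaussianReal {m : ℝ} (hZ : AEMeasurable Z P)
    (h : P.map Z = gaussianReal m v) : MemLp Z 2 P := by
  have hid : MemLp id 2 (P.map Z) := h ▸ memLp_id_gaussianReal 2
  exact (memLp_map_measure_iff aestronglyMeasurable_id hZ).mp hid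

lemma integral_sq_of_map_eq_gaussianReal (hZ : AEMeasurable Z P)
    (h : P.map Z = gaussianReal 0 v) : ∫ ω, Z ω ^ 2 ∂P = v := by
  have hmap : ∫ x, x ^ 2 ∂(P.map Z) = ∫ ω, Z ω ^ 2 ∂P := integral_map hZ (by fun_prop)
  have hvar : Var[fun x => x; gaussianReal 0 v] = v := variance_fun_id_gaussianReal
  rw [variance_of_integral_eq_zero (by fun_prop) integral_id_gaussianReal] at hvar
  rw [← hmap, h, hvar]

lemma integrable_exp_of_map_eq_gaussianReal {m : ℝ} (hZ : AEMeasurable Z P)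
    (h : P.map Z = gaussianReal m v) : Integrable (fun ω => Real.exp (Z ω)) P := by
  have hexp := integrable_exp_mul_gaussianReal (μ := m) (v := v) 1
  rw [← h] at hexp
  simpa [Function.comp_def] using hexp.comp_aemeasurable hZ

lemma integral_exp_of_map_eq_gaussianReal (hZ : AEMeasurable Z P)
    (h : P.map Z = gaussianReal 0 v) :
    ∫ ω, Real.exp (Z ω) ∂P = Real.exp ((∫ ω, Z ω ^ 2 ∂P) / 2) := by
  rw [integral_sq_of_map_eq_gaussianReal hZ h]
  simpa [mgf] using mgf_gaussianReal h 1

end CenteredGaussian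

/-- One-dimensional Cameron–Martin shift: if `(Y, Z)` is a centered Gaussian vector, the law of
`Z` under the measure tilted by `Y` is the law of `Z + E[Y Z]`. -/
lemma map_tilted_eq_map_add_integral_mul {P : Measure Ω} [IsProbabilityMeasure P]
    {Y Z : Ω → ℝ} (hY : Measurable Y) (hZ : Measurable Z)
    (h : ∀ a b : ℝ, ∃ v : ℝ≥0, P.map (fun ω => a * Y ω + b * Z ω) = gaussianReal 0 v) :
    (P.tilted Y).map Z = P.map (fun ω => Z ω + ∫ ω', Y ω' * Z ω' ∂P) := by
  set c := ∫ ω', Y ω' * Z ω' ∂P with hc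
  have hmeas (a b : ℝ) : AEMeasurable (fun ω => a * Y ω + b * Z ω) P := by fun_prop
  have hint (a b : ℝ) : Integrable (fun ω => Real.exp (a * Y ω + b * Z ω)) P :=
    (h a b).elim fun _ hv => integrable_exp_of_map_eq_gaussianReal (hmeas a b) hv
  have hYL : MemLp Y 2 P := by
    obtain ⟨v, hv⟩ := h 1 0
    simpa using memLp_two_of_map_eq_gaussianReal (hmeas 1 0) hv
  have hZL : MemLp Z 2 P := by
    obtain ⟨v, hv⟩ := h 0 1
    simpa using memLp_two_of_map_eq_gaussianReal (hmeas 0 1) hv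
  have hexp (a b : ℝ) : ∫ ω, Real.exp (a * Y ω + b * Z ω) ∂P =
      Real.exp ((a ^ 2 * ∫ ω, Y ω ^ 2 ∂P) / 2 + a * b * c + (b ^ 2 * ∫ ω, Z ω ^ 2 ∂P) / 2) := by
    obtain ⟨v, hv⟩ := h a b
    have hYZ : Integrable (fun ω => Y ω * Z ω) P := hYL.integrable_mul hZL
    have hsq : ∫ ω, (a * Y ω + b * Z ω) ^ 2 ∂P =
        a ^ 2 * ∫ ω, Y ω ^ 2 ∂P + 2 * a * b * c + b ^ 2 * ∫ ω, Z ω ^ 2 ∂P := by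
      rw [hc, ← integral_const_mul, ← integral_const_mul, ← integral_const_mul, ← integral_add,
        ← integral_add]
      · congr with ω
        ring
      · exact (hYL.integrable_sq.const_mul _).add (hYZ.const_mul _)
      · exact hZL.integrable_sq.const_mul _
      · exact hYL.integrable_sq.const_mul _
      · exact hYZ.const_mul _
    rw [integral_exp_of_map_eq_gaussianReal (hmeas a b) hv, hsq]
    ring_nf
  have hintY : Integrable (fun ω => Real.exp (Y ω)) P := by simpa using hint 1 0
  have hexpY : ∫ ω, Real.exp (Y ω) ∂P = Real.exp ((∫ ω, Y ω ^ 2 ∂P) / 2) := by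
    simpa using hexp 1 0
  have := isProbabilityMeasure_tilted hintY
  refine map_eq_map_of_mgf_eq hZ.aemeasurable (by fun_prop) (fun t => ?_) (funext fun t => ?_)
  · rw [integrable_tilted_iff hintY]
    simpa [Real.exp_add] using hint 1 t
  · have h1 := hexp 1 t
    have h0 := hexp 0 t
    simp only [one_mul, zero_mul, zero_add] at h1 h0
    rw [mgf, mgf, integral_exp_tilted]
    simp only [Pi.add_apply, mul_add, Real.exp_add (t * Z _)]
    rw [integral_mul_const, h1, hexpY, h0, ← Real.exp_sub, ← Real.exp_add]
    ring_nf

/-- Two finite measures on a finite product of copies of `ℝ` coincide if all linear combinations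
of the coordinates have the same law. -/
lemma ext_of_map_sum_mul {ι : Type*} [Fintype ι] {μ ν : Measure (ι → ℝ)} [IsFiniteMeasure μ]
    [IsFiniteMeasure ν]
    (h : ∀ l : ι → ℝ, μ.map (fun x => ∑ i, l i * x i) = ν.map (fun x => ∑ i, l i * x i)) :
    μ = ν := by
  classical
  refine Measure.ext_of_charFunDual (funext fun L => ?_)
  have hL : (L : (ι → ℝ) → ℝ) = fun x => ∑ i, L (Pi.single i 1) * x i := by
    ext x
    conv_lhs => rw [pi_eq_sum_univ' x, map_sum]
    refine Finset.sum_congr rfl fun i _ => ?_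
    rw [map_smul, smul_eq_mul, mul_comm]
  rw [charFunDual_eq_charFun_map_one, charFunDual_eq_charFun_map_one, hL, h]

/-- **Cameron–Martin shift** for the law of a centered Gaussian process. -/
lemma map_tilted_pi_eq_map_add_integral_mul {P : Measure Ω} [IsProbabilityMeasure P] {D : Type*}
    {X : D → Ω → ℝ} {Y : Ω → ℝ} (hY : Measurable Y) (hX : ∀ x, Measurable (X x))
    (h : ∀ (n : ℕ) (x : Fin n → D) (a : ℝ) (l : Fin n → ℝ), ∃ v : ℝ≥0,
      P.map (fun ω => a * Y ω + ∑ i, l i * X (x i) ω) = gaussianReal 0 v) :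
    (P.tilted Y).map (fun ω x => X x ω) =
      P.map (fun ω x => X x ω + ∫ ω', Y ω' * X x ω' ∂P) := by
  have hYL : MemLp Y 2 P := by
    obtain ⟨v, hv⟩ := h 0 Fin.elim0 1 Fin.elim0
    simp only [one_mul, Finset.univ_eq_empty, Finset.sum_empty, add_zero] at hv
    exact memLp_two_of_map_eq_gaussianReal hY.aemeasurable hv
  have hXL (x : D) : MemLp (X x) 2 P := by
    obtain ⟨v, hv⟩ := h 1 (fun _ => x) 0 1
    simp only [zero_mul, zero_add, Pi.one_apply, one_mul, Finset.univ_unique,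
      Finset.sum_singleton] at hv
    exact memLp_two_of_map_eq_gaussianReal (hX x).aemeasurable hv
  refine IsProjectiveLimit.unique
    (P := fun I : Finset D => ((P.tilted Y).map (fun ω x => X x ω)).map I.restrict)
    (fun I => rfl) (fun I => ?_)
  refine ext_of_map_sum_mul fun l => ?_
  rw [Measure.map_map (by fun_prop) (by fun_prop), Measure.map_map (by fun_prop) (by fun_prop),
    Measure.map_map (by fun_prop) (by fun_prop), Measure.map_map (by fun_prop) (by fun_prop)]
  have hshift := map_tilted_eq_map_add_integral_mul (P := P) (Y := Y)
    (Z := fun ω => ∑ i : I, l i * X i ω) hY (by fun_prop) fun a b => by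
      obtain ⟨v, hv⟩ := h _ (fun k => (I.equivFin.symm k : D)) a
        (fun k => b * l (I.equivFin.symm k))
      refine ⟨v, hv ▸ ?_⟩
      congr with ω
      rw [Equiv.sum_comp I.equivFin.symm (fun i : I => b * l i * X i ω), Finset.mul_sum]
      simp only [mul_assoc]
  have hcov : ∫ ω, Y ω * ∑ i : I, l i * X i ω ∂P = ∑ i : I, l i * ∫ ω, Y ω * X i ω ∂P := by
    simp only [Finset.mul_sum, mul_left_comm (Y _)]
    have hint (i : I) : Integrable (fun ω => l i * (Y ω * X i ω)) P :=
      (hYL.integrable_mul (hXL i)).const_mul (l i)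
    rw [integral_finsetSum _ fun i _ => hint i]
    simp only [integral_const_mul]
  rw [hcov] at hshift
  convert hshift.symm using 2
  · ext ω
    simp [mul_add, Finset.sum_add_distrib]
  · ext ω
    simp

end ProbabilityTheory

open scoped NNReal

/-- **Girsanov transform / Cameron–Martin shift.** Let `(Ω, F, P)` be a probability space,
`X : D → Ω → ℝ` a family of random variables and `Y` a random variable such that every finite
collection `(Y, X x₁, …, X xₙ)` is a centered Gaussian vector (expressed here by requiring every
real linear combination `a Y + ∑ lᵢ X xᵢ` to have a centered Gaussian law). Then for every
bounded function `F` on `D → ℝ`, measurable for the product σ-algebra,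
`E[e^{Y - E[Y²]/2} F((X x)_x)] = E[F((X x + E[Y ⬝ X x])_x)]`. -/
theorem girsanov_transform {Ω : Type*} [MeasurableSpace Ω] (P : Measure Ω)
    [IsProbabilityMeasure P] {D : Type*} (X : D → Ω → ℝ) (Y : Ω → ℝ)
    (hY : Measurable Y) (hX : ∀ x, Measurable (X x))
    (hGauss : ∀ (n : ℕ) (x : Fin n → D) (a : ℝ) (l : Fin n → ℝ), ∃ v : ℝ≥0,
      Measure.map (fun ω => a * Y ω + ∑ i, l i * X (x i) ω) P = gaussianReal 0 v)
    (F : (D → ℝ) → ℝ) (hF : Measurable F) (hFbdd : ∃ B, ∀ u, |F u| ≤ B) :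
    ∫ ω, Real.exp (Y ω - (∫ ω', (Y ω') ^ 2 ∂P) / 2) * F (fun x => X x ω) ∂P =
      ∫ ω, F (fun x => X x ω + ∫ ω', Y ω' * X x ω' ∂P) ∂P := by
  have hexpY : ∫ ω, Real.exp (Y ω) ∂P = Real.exp ((∫ ω, Y ω ^ 2 ∂P) / 2) := by
    obtain ⟨v, hv⟩ := hGauss 0 Fin.elim0 1 Fin.elim0
    simp only [one_mul, Finset.univ_eq_empty, Finset.sum_empty, add_zero] at hv
    exact integral_exp_of_map_eq_gaussianReal hY.aemeasurable hv
  calc ∫ ω, Real.exp (Y ω - (∫ ω', (Y ω') ^ 2 ∂P) / 2) * F (fun x => X x ω) ∂P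
      = ∫ ω, F (fun x => X x ω) ∂(P.tilted Y) := by
        rw [integral_tilted]
        simp only [hexpY, Real.exp_sub, smul_eq_mul]
    _ = ∫ u, F u ∂((P.tilted Y).map fun ω x => X x ω) :=
        (integral_map (measurable_pi_lambda _ hX).aemeasurable hF.aestronglyMeasurable).symm
    _ = ∫ ω, F (fun x => X x ω + ∫ ω', Y ω' * X x ω' ∂P) ∂P := by
        rw [map_tilted_pi_eq_map_add_integral_mul hY hX hGauss]
        exact integral_map
          (measurable_pi_lambda _ fun x => (hX x).add_const _).aemeasurable hF.aestronglyMeasurable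
end

section
/- Kahane's convexity inequality: Let D be a compact metric space, σ a finite Borel measure on D, and let (Y(x))_{x∈D} and (Z(x))_{x∈D} be centered Gaussian processes (each defined on a probability space) with almost surely continuous sample paths, satisfying E[Y(x)Y(y)] ≤ E[Z(x)Z(y)] for all x, y ∈ D. Then for every convex function F : [0,∞) → ℝ with at most polynomial growth at infinity (there exist C, N with |F(t)| ≤ C(1+t)^N for all t ≥ 0), one has E[ F( ∫_D e^{Y(x) − E[Y(x)²]/2} σ(dx) ) ] ≤ E[ F( ∫_D e^{Z(x) − E[Z(x)²]/2} σ(dx) ) ], and the reverse inequality holds when F is concave with at most polynomial growth. -/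
open MeasureTheory ProbabilityTheory
open scoped NNReal

namespace Kahane

open Filter Topology

/-- Second-order Taylor estimate with a Lipschitz second derivative. -/
lemma abs_taylor_two_le {g g₁ g₂ : ℝ → ℝ} {L : ℝ} (h₁ : ∀ x, HasDerivAt g (g₁ x) x)
    (h₂ : ∀ x, HasDerivAt g₁ (g₂ x) x) (hL : ∀ x y, |g₂ x - g₂ y| ≤ L * |x - y|) (x y : ℝ) :
    |g y - g x - g₁ x * (y - x) - g₂ x / 2 * (y - x) ^ 2| ≤ L * |y - x| ^ 3 := by
  have hL0 : 0 ≤ L := by simpa using (abs_nonneg _).trans (hL 1 0)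
  have hs : ∀ s ∈ Set.uIcc x y, |s - x| ≤ |y - x| := fun s hs ↦
    Set.abs_sub_left_of_mem_uIcc hs
  have hc : Convex ℝ (Set.uIcc x y) := convex_uIcc x y
  have key : ∀ s ∈ Set.uIcc x y, |g₁ s - g₁ x - g₂ x * (s - x)| ≤ L * |y - x| ^ 2 := by
    intro s hsm
    have hd : ∀ u ∈ Set.uIcc x y,
        HasDerivWithinAt (fun u ↦ g₁ u - g₁ x - g₂ x * (u - x)) (g₂ u - g₂ x)
          (Set.uIcc x y) u := by
      intro u _
      have := ((h₂ u).sub_const (g₁ x)).sub (((hasDerivAt_id u).sub_const x).const_mul (g₂ x))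
      exact (this.congr_deriv (by simp)).hasDerivWithinAt
    have hb : ∀ u ∈ Set.uIcc x y, ‖g₂ u - g₂ x‖ ≤ L * |y - x| := fun u hu ↦
      (hL u x).trans (mul_le_mul_of_nonneg_left (hs u hu) hL0)
    have := hc.norm_image_sub_le_of_norm_hasDerivWithin_le hd hb Set.left_mem_uIcc hsm
    simp only [sub_self, mul_zero, sub_zero, Real.norm_eq_abs] at this
    calc _ ≤ _ := this
      _ ≤ L * |y - x| * |y - x| := mul_le_mul_of_nonneg_left (hs s hsm) (by positivity)
      _ = _ := by ring
  have hd : ∀ u ∈ Set.uIcc x y,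
      HasDerivWithinAt (fun u ↦ g u - g x - g₁ x * (u - x) - g₂ x / 2 * (u - x) ^ 2)
        (g₁ u - g₁ x - g₂ x * (u - x)) (Set.uIcc x y) u := by
    intro u _
    have := (((h₁ u).sub_const (g x)).sub
      (((hasDerivAt_id u).sub_const x).const_mul (g₁ x))).sub
      ((((hasDerivAt_id u).sub_const x).pow 2).const_mul (g₂ x / 2))
    refine (this.congr_deriv ?_).hasDerivWithinAt
    simp
    ring
  have := hc.norm_image_sub_le_of_norm_hasDerivWithin_le hd key Set.left_mem_uIcc
    Set.right_mem_uIcc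
  simp only [sub_self, mul_zero, sub_zero, Real.norm_eq_abs, ne_eq, OfNat.ofNat_ne_zero,
    not_false_eq_true, zero_pow] at this
  calc _ ≤ _ := this
    _ = _ := by ring

lemma exists_smooth_approx_of_convex {F : ℝ → ℝ} (hF : ConvexOn ℝ Set.univ F) {K : ℝ≥0}
    (hK : LipschitzWith K F) {ε : ℝ} (hε : 0 < ε) :
    ∃ (g g₁ g₂ : ℝ → ℝ) (L : ℝ), (∀ x, HasDerivAt g (g₁ x) x) ∧
      (∀ x, HasDerivAt g₁ (g₂ x) x) ∧ (∀ x y, |g₂ x - g₂ y| ≤ L * |x - y|) ∧ (∀ x, 0 ≤ g₂ x) ∧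
      ∀ x, |g x - F x| ≤ 10 * K * ε := by
  have hFc := hK.continuous
  have hFl : ∀ x y, |F x - F y| ≤ K * |x - y| := fun x y ↦ by
    simpa [Real.dist_eq] using hK.dist_le_mul x y
  set P : ℝ → ℝ := fun t ↦ ∫ s in (0 : ℝ)..t, F s with hP
  have hPd : ∀ t, HasDerivAt P (F t) t := fun t ↦ hFc.integral_hasStrictDerivAt 0 t |>.hasDerivAt
  have hPc : Continuous P := continuous_iff_continuousAt.2 fun x ↦ (hPd x).continuousAt
  set Q : ℝ → ℝ := fun t ↦ ∫ s in (0 : ℝ)..t, P s with hQ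
  have hQd : ∀ t, HasDerivAt Q (P t) t := fun t ↦ hPc.integral_hasStrictDerivAt 0 t |>.hasDerivAt
  have hdiff : ∀ {f f' : ℝ → ℝ}, (∀ t, HasDerivAt f (f' t) t) → ∀ t,
      HasDerivAt (fun t ↦ (ε ^ 2)⁻¹ * (f (t + 2 * ε) - 2 * f (t + ε) + f t))
        ((ε ^ 2)⁻¹ * (f' (t + 2 * ε) - 2 * f' (t + ε) + f' t)) t := fun h t ↦
    ((((h _).comp_add_const t _).sub (((h _).comp_add_const t _).const_mul 2)).add (h t)).const_mul _
  refine ⟨_, _, _, (ε ^ 2)⁻¹ * (4 * K), hdiff hQd, hdiff hPd, fun x y ↦ ?_, fun x ↦ ?_,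
    fun x ↦ ?_⟩
  · rw [← mul_sub, abs_mul, abs_of_pos (by positivity), mul_assoc]
    gcongr
    have h1 := abs_le.1 (hFl (x + 2 * ε) (y + 2 * ε))
    have h2 := abs_le.1 (hFl (x + ε) (y + ε))
    have h3 := abs_le.1 (hFl x y)
    simp only [add_sub_add_right_eq_sub] at h1 h2
    rw [abs_le]
    constructor <;> linarith [h1.1, h1.2, h2.1, h2.2, h3.1, h3.2]
  · have := hF.2 (Set.mem_univ x) (Set.mem_univ (x + 2 * ε))
      (by norm_num : (0 : ℝ) ≤ 1 / 2) (by norm_num : (0 : ℝ) ≤ 1 / 2) (by norm_num)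
    simp only [smul_eq_mul] at this
    rw [show 1 / 2 * x + 1 / 2 * (x + 2 * ε) = x + ε by ring] at this
    have h2 : 0 ≤ F (x + 2 * ε) - 2 * F (x + ε) + F x := by linarith
    positivity
  · have h1 := abs_le.1 (abs_taylor_two_le hQd hPd hFl x (x + 2 * ε))
    have h2 := abs_le.1 (abs_taylor_two_le hQd hPd hFl x (x + ε))
    simp only [add_sub_cancel_left, abs_of_pos hε, abs_of_pos (show 0 < 2 * ε by positivity)]
      at h1 h2
    have : (ε ^ 2)⁻¹ * (Q (x + 2 * ε) - 2 * Q (x + ε) + Q x) - F x =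
        (ε ^ 2)⁻¹ * (Q (x + 2 * ε) - 2 * Q (x + ε) + Q x - F x * ε ^ 2) := by
      field_simp
    rw [this, abs_mul, abs_of_pos (by positivity), inv_mul_le_iff₀ (by positivity), abs_le]
    constructor <;> nlinarith [h1.1, h1.2, h2.1, h2.2]

lemma exists_subgradient {F : ℝ → ℝ} {s : Set ℝ} (hF : ConvexOn ℝ s F) :
    ∃ c : ℝ → ℝ, ∀ x ∈ interior s, ∀ y ∈ s, F x + c x * (y - x) ≤ F y := by
  refine ⟨fun x ↦ derivWithin F (Set.Ioi x) x, fun x hx y hy ↦ ?_⟩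
  rcases lt_trichotomy x y with hxy | rfl | hxy
  · have := hF.rightDeriv_le_slope_of_mem_interior hx hy hxy
    rw [slope_def_field, le_div_iff₀ (by linarith)] at this
    linarith
  · simp
  · have := (hF.slope_le_leftDeriv_of_mem_interior hy hx hxy).trans
      (hF.leftDeriv_le_rightDeriv_of_mem_interior hx)
    rw [slope_def_field, div_le_iff₀ (by linarith)] at this
    linarith

/-- A convex function on `[0, ∞)` is, on `(0, ∞)`, an increasing limit of Lipschitz convex
functions. -/
lemma exists_lipschitz_convex_approx {F : ℝ → ℝ} (hF : ConvexOn ℝ (Set.Ici 0) F) :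
    ∃ G : ℕ → ℝ → ℝ, (∀ n, ConvexOn ℝ Set.univ (G n)) ∧ (∀ n, ∃ K : ℝ≥0, LipschitzWith K (G n)) ∧
      Monotone G ∧ (∀ n t, 0 ≤ t → G n t ≤ F t) ∧
      ∀ t, 0 < t → Tendsto (fun n ↦ G n t) atTop (𝓝 (F t)) := by
  obtain ⟨c, hc⟩ := exists_subgradient hF
  simp only [interior_Ici, Set.mem_Ioi, Set.mem_Ici] at hc
  have : Nonempty {q : ℚ // 0 < q} := ⟨⟨1, one_pos⟩⟩
  obtain ⟨e, he⟩ := exists_surjective_nat {q : ℚ // 0 < q}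
  set A : ℕ → ℝ → ℝ := fun n t ↦ F (e n).1 + c (e n).1 * (t - (e n).1) with hA
  have hAF : ∀ n t, 0 ≤ t → A n t ≤ F t := fun n t ht ↦
    hc _ (by exact_mod_cast (e n).2) _ ht
  have hAc : ∀ n, ConvexOn ℝ Set.univ (A n) := by
    refine fun n ↦ ⟨convex_univ, fun x _ y _ a b _ _ hab ↦ le_of_eq ?_⟩
    simp only [hA, smul_eq_mul]
    linear_combination (-F (e n).1 + c (e n).1 * (e n).1) * hab
  have hAl : ∀ n, ∃ K : ℝ≥0, LipschitzWith K (A n) := fun n ↦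
    ⟨‖c (e n).1‖₊, LipschitzWith.of_dist_le_mul fun x y ↦ by
      simp [hA, Real.dist_eq, ← mul_sub, abs_mul]⟩
  have hsucc : ∀ n, partialSups A (n + 1) = partialSups A n ⊔ A (n + 1) := fun n ↦ by
    rw [partialSups_add_one]
  refine ⟨partialSups A, fun n ↦ ?_, fun n ↦ ?_, (partialSups A).monotone, fun n t ht ↦ ?_,
    fun t ht ↦ ?_⟩
  · induction n with
    | zero => simpa using hAc 0
    | succ n ih => rw [hsucc]; exact ih.sup (hAc _)
  · induction n with
    | zero => simpa using hAl 0
    | succ n ih =>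
      obtain ⟨K, hK⟩ := ih
      obtain ⟨K', hK'⟩ := hAl (n + 1)
      exact ⟨max K K', by rw [hsucc]; exact hK.max hK'⟩
  · induction n with
    | zero => simpa using hAF 0 t ht
    | succ n ih => rw [hsucc]; exact sup_le ih (hAF _ t ht)
  · have hmono : Monotone fun n ↦ partialSups A n t := fun m n hmn ↦
      (partialSups A).monotone hmn t
    have hle : ∀ n, partialSups A n t ≤ F t := fun n ↦ by
      induction n with
      | zero => simpa using hAF 0 t ht.le
      | succ n ih => rw [hsucc]; exact sup_le ih (hAF _ t ht.le)
    refine tendsto_order.2 ⟨fun a ha ↦ ?_, fun a ha ↦ .of_forall fun n ↦ (hle n).trans_lt ha⟩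
    set d := |c (t + 1) - c t| + 1 with hd
    have hd0 : 0 < d := by positivity
    set δ := min 1 ((F t - a) / d) with hδ
    have hδ0 : 0 < δ := lt_min one_pos (div_pos (by linarith) hd0)
    obtain ⟨q, hq1, hq2⟩ := exists_rat_btwn (show t < t + δ by linarith)
    obtain ⟨k, hk⟩ := he ⟨q, by exact_mod_cast ht.trans hq1⟩
    have hq3 : (q : ℝ) < t + 1 := hq2.trans_le (by linarith [min_le_left 1 ((F t - a) / d)])
    have hq4 : ((q : ℝ) - t) * d < F t - a := by
      rw [← lt_div_iff₀ hd0]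
      linarith [min_le_right 1 ((F t - a) / d)]
    have hkA : A k t = F q + c q * (t - q) := by simp [hA, hk]
    have s1 := hc t ht q (by linarith)
    have s2 := hc q (by linarith) (t + 1) (by linarith)
    have s3 := hc (t + 1) (by linarith) q (by linarith)
    have s4 : c q ≤ c (t + 1) := by
      by_contra hcon
      nlinarith
    have s5 : c (t + 1) - c t ≤ d := by linarith [le_abs_self (c (t + 1) - c t)]
    have hak : a < A k t := by
      rw [hkA]
      nlinarith
    filter_upwards [eventually_ge_atTop k] with n hn
    exact hak.trans_le ((le_partialSups A k t).trans (hmono hn))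

/-- **Scheffé's lemma** for nonnegative real functions. -/
lemma tendsto_integral_abs_sub_of_tendsto {α : Type*} {m : MeasurableSpace α} {μ : Measure α}
    {f : ℕ → α → ℝ} {g : α → ℝ} (hf : ∀ n, Integrable (f n) μ) (hg : Integrable g μ)
    (hf0 : ∀ n x, 0 ≤ f n x) (hg0 : ∀ x, 0 ≤ g x)
    (hlim : ∀ x, Tendsto (fun n ↦ f n x) atTop (𝓝 (g x)))
    (hI : ∀ n, ∫ x, f n x ∂μ = ∫ x, g x ∂μ) :
    Tendsto (fun n ↦ ∫ x, |f n x - g x| ∂μ) atTop (𝓝 0) := by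
  have hpos : ∀ n, Integrable (fun x ↦ max (g x - f n x) 0) μ := fun n ↦
    (hg.sub' (hf n)).pos_part
  have h1 : Tendsto (fun n ↦ ∫ x, max (g x - f n x) 0 ∂μ) atTop (𝓝 (∫ _, (0 : ℝ) ∂μ)) := by
    refine tendsto_integral_of_dominated_convergence g (fun n ↦ (hpos n).1) hg
      (fun n ↦ .of_forall fun x ↦ ?_) (.of_forall fun x ↦ ?_)
    · rw [Real.norm_eq_abs, abs_of_nonneg (le_max_right _ _)]
      exact max_le (by linarith [hf0 n x]) (hg0 x)
    · have : Tendsto (fun n ↦ max (g x - f n x) 0) atTop (𝓝 (max (g x - g x) 0)) :=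
        (tendsto_const_nhds.sub (hlim x)).max tendsto_const_nhds
      simpa using this
  have h2 : ∀ n, ∫ x, |f n x - g x| ∂μ = 2 * ∫ x, max (g x - f n x) 0 ∂μ := by
    intro n
    have hz : ∀ x, |f n x - g x| = (f n x - g x) + 2 * max (g x - f n x) 0 := by
      intro x
      rcases le_total (f n x) (g x) with h | h
      · rw [abs_of_nonpos (by linarith), max_eq_left (by linarith)]
        ring
      · rw [abs_of_nonneg (by linarith), max_eq_right (by linarith)]
        ring
    simp only [hz]
    rw [integral_add ((hf n).sub' hg) ((hpos n).const_mul 2), integral_sub (hf n) hg, hI n,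
      integral_const_mul]
    ring
  simp only [h2]
  simpa using h1.const_mul 2

lemma integral_comp_simpleFunc_nat {α : Type*} {m : MeasurableSpace α} (μ : Measure α)
    [IsFiniteMeasure μ] (s : SimpleFunc α ℕ) {N : ℕ} (hs : ∀ x, s x ≤ N) (f : ℕ → ℝ) :
    ∫ x, f (s x) ∂μ = ∑ k : Fin (N + 1), μ.real (s ⁻¹' {(k : ℕ)}) * f k := by
  have hz : ∀ x, f (s x) = ∑ k : Fin (N + 1), (s ⁻¹' {(k : ℕ)}).indicator (fun _ ↦ f k) x := by
    intro x
    rw [Finset.sum_eq_single ⟨s x, Nat.lt_succ_of_le (hs x)⟩]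
    · simp
    · intro k _ hk
      refine Set.indicator_of_notMem (fun h ↦ hk (Fin.ext ?_)) _
      exact h.symm
    · simp
  simp only [hz]
  rw [integral_finsetSum _ fun k _ ↦ (integrable_const _).indicator (s.measurableSet_preimage _)]
  refine Finset.sum_congr rfl fun k _ ↦ ?_
  rw [integral_indicator_const _ (s.measurableSet_preimage _), smul_eq_mul]

section FiniteDimensional

variable {ι : Type*} [Fintype ι]

/-- The discrete analogue `∑ pᵢ exp (zᵢ - Aᵢᵢ / 2)` of the multiplicative chaos mass. -/
noncomputable def wickSum (p : ι → ℝ) (A : Matrix ι ι ℝ) (z : EuclideanSpace ℝ ι) : ℝ :=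
  ∑ i, p i * Real.exp (z i - A i i / 2)

@[fun_prop]
lemma continuous_wickSum (p : ι → ℝ) (A : Matrix ι ι ℝ) : Continuous (wickSum p A) := by
  unfold wickSum
  fun_prop

variable [DecidableEq ι]

/-- Laplace transform of a centered multivariate Gaussian. -/
lemma multivariateGaussian_exp {A : Matrix ι ι ℝ} (hA : A.PosSemidef) (t : ι → ℝ) :
    Integrable (fun z ↦ Real.exp (∑ i, t i * z i)) (multivariateGaussian 0 A) ∧
      ∫ z, Real.exp (∑ i, t i * z i) ∂(multivariateGaussian 0 A)
        = Real.exp ((∑ i, ∑ j, t i * A i j * t j) / 2) := by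
  set μ := multivariateGaussian 0 A
  let L : StrongDual ℝ (EuclideanSpace ℝ ι) := innerSL ℝ (WithLp.toLp 2 t)
  have hL : ∀ z, L z = ∑ i, t i * z i := by
    intro z
    simp [L, PiLp.inner_apply, mul_comm]
  have hmean : μ[L] = 0 := by
    rw [IsGaussian.integral_dual]
    simp [μ]
  have hvar : Var[L; μ] = ∑ i, ∑ j, t i * A i j * t j := by
    have h1 := covarianceBilin_multivariateGaussian (μ := 0) hA (WithLp.toLp 2 t) (WithLp.toLp 2 t)
    rw [covarianceBilin_self IsGaussian.memLp_two_id] at h1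
    have h2 : (fun u ↦ inner ℝ (WithLp.toLp 2 t) u) = (L : EuclideanSpace ℝ ι → ℝ) := rfl
    rw [h2] at h1
    rw [h1]
    simp only [dotProduct, Matrix.mulVec, Finset.mul_sum]
    exact Finset.sum_congr rfl fun i _ ↦ Finset.sum_congr rfl fun j _ ↦ by ring
  have hmap : μ.map L = gaussianReal 0 (Var[L; μ]).toNNReal := by
    rw [IsGaussian.map_eq_gaussianReal L, hmean]
  have hv : ((Var[L; μ]).toNNReal : ℝ) = ∑ i, ∑ j, t i * A i j * t j := by
    rw [Real.coe_toNNReal _ (variance_nonneg _ _), hvar]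
  have hmgf := mgf_gaussianReal hmap 1
  simp only [mgf, one_mul, zero_add, hv, one_pow, mul_one, hL] at hmgf
  refine ⟨?_, hmgf⟩
  by_contra h
  rw [integral_undef h] at hmgf
  exact (Real.exp_pos _).ne hmgf

lemma multivariateGaussian_exp_mul_sub {A : Matrix ι ι ℝ} (hA : A.PosSemidef) (i : ι) (c d : ℝ) :
    Integrable (fun z ↦ Real.exp (c * z i - d)) (multivariateGaussian 0 A) ∧
      ∫ z, Real.exp (c * z i - d) ∂(multivariateGaussian 0 A)
        = Real.exp (c ^ 2 * A i i / 2 - d) := by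
  obtain ⟨h1, h2⟩ := multivariateGaussian_exp hA (Pi.single i c)
  have hz : ∀ z : EuclideanSpace ℝ ι, ∑ j, (Pi.single i c : ι → ℝ) j * z j = c * z i := by
    intro z
    rw [Finset.sum_eq_single i] <;> simp +contextual
  have hq : ∑ j, ∑ k, (Pi.single i c : ι → ℝ) j * A j k * (Pi.single i c : ι → ℝ) k
      = c ^ 2 * A i i := by
    rw [Finset.sum_eq_single i, Finset.sum_eq_single i] <;>
      simp +contextual [Pi.single_apply]
    ring
  simp only [hz, hq] at h1 h2
  simp only [Real.exp_sub]
  exact ⟨h1.div_const _, by rw [integral_div, h2]⟩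

lemma multivariateGaussian_exp_add_sub {A : Matrix ι ι ℝ} (hA : A.PosSemidef) (i j : ι) (d : ℝ) :
    Integrable (fun z ↦ Real.exp (z i + z j - d)) (multivariateGaussian 0 A) ∧
      ∫ z, Real.exp (z i + z j - d) ∂(multivariateGaussian 0 A)
        = Real.exp (A i i / 2 + A j j / 2 + A i j - d) := by
  obtain ⟨h1, h2⟩ := multivariateGaussian_exp hA (Pi.single i 1 + Pi.single j 1)
  have hz : ∀ z : EuclideanSpace ℝ ι,
      ∑ k, (Pi.single i 1 + Pi.single j 1 : ι → ℝ) k * z k = z i + z j := by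
    intro z
    simp [add_mul, Finset.sum_add_distrib, Pi.single_apply]
  have hsymm : A j i = A i j := by simpa using hA.isHermitian.apply i j
  have hq : (∑ k, ∑ l, (Pi.single i 1 + Pi.single j 1 : ι → ℝ) k * A k l *
      (Pi.single i 1 + Pi.single j 1 : ι → ℝ) l) / 2 = A i i / 2 + A j j / 2 + A i j := by
    simp [add_mul, mul_add, Finset.sum_add_distrib, Pi.single_apply, hsymm]
    ring
  simp only [hz, hq] at h1 h2
  simp only [Real.exp_sub _ d]
  exact ⟨h1.div_const _, by rw [integral_div, h2]⟩

lemma exp_sub_one_le_mul_exp (a : ℝ) : Real.exp a - 1 ≤ a * Real.exp a := by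
  have h := Real.add_one_le_exp (-a)
  have h2 : Real.exp (-a) * Real.exp a = 1 := by rw [← Real.exp_add]; simp
  nlinarith [Real.exp_pos a]

/-- Third absolute moment of a normalized lognormal variable around its mean. -/
lemma integral_abs_exp_sub_one_cube_le {A : Matrix ι ι ℝ} (hA : A.PosSemidef) (i : ι) {V h : ℝ}
    (hh : 0 < h) (hh1 : h ≤ 1) (hV : A i i ≤ V * h) :
    Integrable (fun z ↦ |Real.exp (z i - A i i / 2) - 1| ^ 3) (multivariateGaussian 0 A) ∧
      ∫ z, |Real.exp (z i - A i i / 2) - 1| ^ 3 ∂(multivariateGaussian 0 A)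
        ≤ (V * Real.exp V + 6 * V ^ 2 * Real.exp (6 * V)) * (h * √h) := by
  set μ := multivariateGaussian 0 A
  set a := A i i with ha
  have ha0 : 0 ≤ a := hA.diag_nonneg
  have hV0 : 0 ≤ V := by
    by_contra hneg
    nlinarith
  have haV : a ≤ V := by nlinarith
  have hmom : ∀ k : ℕ, Integrable (fun z : EuclideanSpace ℝ ι ↦ Real.exp (z i - a / 2) ^ k) μ ∧
      ∫ z, Real.exp (z i - a / 2) ^ k ∂μ = Real.exp ((k ^ 2 - k) / 2 * a) := by
    intro k
    have := multivariateGaussian_exp_mul_sub hA i k (k * (a / 2))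
    have hz : ∀ z : EuclideanSpace ℝ ι,
        Real.exp (k * z i - k * (a / 2)) = Real.exp (z i - a / 2) ^ k := by
      intro z
      rw [← Real.exp_nat_mul]
      ring_nf
    simp only [hz] at this
    refine ⟨this.1, this.2.trans ?_⟩
    congr 1
    ring
  have m1 := hmom 1
  have m2 := hmom 2
  have m3 := hmom 3
  have m4 := hmom 4
  set s := √h with hs
  have hs0 : 0 < s := Real.sqrt_pos.2 hh
  have hss : s * s = h := Real.mul_self_sqrt hh.le
  set E := Real.exp a with hE
  have hE1 : 1 ≤ E := Real.one_le_exp ha0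
  norm_num at m1 m2 m3 m4
  have e3 : Real.exp (3 * a) = E ^ 3 := by rw [hE, ← Real.exp_nat_mul]; norm_num
  have e6 : Real.exp (6 * a) = E ^ 6 := by rw [hE, ← Real.exp_nat_mul]; norm_num
  rw [e3] at m3
  rw [e6] at m4
  have i2 : Integrable (fun z : EuclideanSpace ℝ ι ↦ (Real.exp (z i - a / 2) - 1) ^ 2) μ ∧
      ∫ z, (Real.exp (z i - a / 2) - 1) ^ 2 ∂μ = E - 1 := by
    have hz : ∀ z : EuclideanSpace ℝ ι, (Real.exp (z i - a / 2) - 1) ^ 2 =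
        Real.exp (z i - a / 2) ^ 2 - 2 * Real.exp (z i - a / 2) + 1 := fun z ↦ by ring
    simp only [hz]
    refine ⟨(m2.1.sub' (m1.1.const_mul 2)).add (integrable_const 1), ?_⟩
    rw [integral_add (m2.1.sub' (m1.1.const_mul 2)) (integrable_const 1),
      integral_sub m2.1 (m1.1.const_mul 2), integral_const_mul, m1.2, m2.2]
    simp
    ring
  have i4 : Integrable (fun z : EuclideanSpace ℝ ι ↦ (Real.exp (z i - a / 2) - 1) ^ 4) μ ∧
      ∫ z, (Real.exp (z i - a / 2) - 1) ^ 4 ∂μ = E ^ 6 - 4 * E ^ 3 + 6 * E - 3 := by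
    have hz : ∀ z : EuclideanSpace ℝ ι, (Real.exp (z i - a / 2) - 1) ^ 4 =
        (Real.exp (z i - a / 2) ^ 4 - 4 * Real.exp (z i - a / 2) ^ 3) +
        ((6 * Real.exp (z i - a / 2) ^ 2 - 4 * Real.exp (z i - a / 2)) + 1) := fun z ↦ by ring
    simp only [hz]
    have j1 := m4.1.sub' (m3.1.const_mul 4)
    have j2 := (m2.1.const_mul 6).sub' (m1.1.const_mul 4)
    have j3 := j2.fun_add (integrable_const (μ := μ) (1 : ℝ))
    refine ⟨j1.add j3, (integral_add j1 j3).trans ?_⟩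
    have t1 : ∫ z, Real.exp (z.ofLp i - a / 2) ^ 4 - 4 * Real.exp (z.ofLp i - a / 2) ^ 3 ∂μ
        = E ^ 6 - 4 * E ^ 3 := by
      rw [integral_sub m4.1 (m3.1.const_mul 4), integral_const_mul, m4.2, m3.2]
    have t2 : ∫ z, (6 * Real.exp (z.ofLp i - a / 2) ^ 2 - 4 * Real.exp (z.ofLp i - a / 2)) + 1 ∂μ
        = 6 * E - 4 + 1 := by
      rw [integral_add j2 (integrable_const 1), integral_sub (m2.1.const_mul 6)
        (m1.1.const_mul 4), integral_const_mul, integral_const_mul, m2.2, m1.2]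
      simp [hE]
    refine (congrArg₂ (· + ·) t1 t2).trans ?_
    ring
  have hpt : ∀ x : ℝ, |x| ^ 3 ≤ (s * x ^ 2 + s⁻¹ * x ^ 4) / 2 := by
    intro x
    have h1 : (s * x ^ 2 + s⁻¹ * x ^ 4) / 2 - |x| ^ 3 = x ^ 2 * s⁻¹ * (s - |x|) ^ 2 / 2 := by
      have h2 : x ^ 2 = |x| ^ 2 := (sq_abs x).symm
      have h4 : x ^ 4 = |x| ^ 4 := by
        rw [show 4 = 2 * 2 from rfl, pow_mul, pow_mul, sq_abs]
      rw [h4, h2]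
      field_simp
      ring
    have : 0 ≤ x ^ 2 * s⁻¹ * (s - |x|) ^ 2 / 2 := by positivity
    linarith
  have hint := ((i2.1.const_mul s).add (i4.1.const_mul s⁻¹)).div_const 2
  have hint3 : Integrable (fun z : EuclideanSpace ℝ ι ↦ |Real.exp (z i - a / 2) - 1| ^ 3) μ := by
    refine hint.mono' ?_ (.of_forall fun z ↦ ?_)
    · exact (by fun_prop : Measurable fun z : EuclideanSpace ℝ ι ↦
        |Real.exp (z i - a / 2) - 1| ^ 3).aestronglyMeasurable
    · rw [Real.norm_eq_abs, abs_of_nonneg (by positivity)]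
      exact hpt _
  refine ⟨hint3, ?_⟩
  have hle : ∫ z, |Real.exp (z i - a / 2) - 1| ^ 3 ∂μ
      ≤ (s * (E - 1) + s⁻¹ * (E ^ 6 - 4 * E ^ 3 + 6 * E - 3)) / 2 := by
    refine (integral_mono hint3 hint fun z ↦ hpt _).trans_eq ?_
    simp only [Pi.add_apply]
    rw [integral_div, integral_add (i2.1.const_mul s) (i4.1.const_mul s⁻¹), integral_const_mul,
      integral_const_mul, i2.2, i4.2]
  have hEV : E ≤ Real.exp V := Real.exp_le_exp.2 haV
  have b1 : E - 1 ≤ V * Real.exp V * h := by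
    calc E - 1 ≤ a * E := exp_sub_one_le_mul_exp a
      _ ≤ (V * h) * Real.exp V := by gcongr
      _ = _ := by ring
  have b2 : E ^ 6 - 4 * E ^ 3 + 6 * E - 3 ≤ 6 * V ^ 2 * Real.exp (6 * V) * h ^ 2 := by
    have h0 : E - 1 ≤ a * E := exp_sub_one_le_mul_exp a
    have hE4 : E ^ 4 + 2 * E ^ 3 + 3 * E ^ 2 - 3 ≤ 6 * E ^ 4 := by
      have : E ^ 3 ≤ E ^ 4 := pow_le_pow_right₀ hE1 (by norm_num)
      have : E ^ 2 ≤ E ^ 4 := pow_le_pow_right₀ hE1 (by norm_num)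
      linarith
    calc E ^ 6 - 4 * E ^ 3 + 6 * E - 3
        = (E - 1) ^ 2 * (E ^ 4 + 2 * E ^ 3 + 3 * E ^ 2 - 3) := by ring
      _ ≤ (E - 1) ^ 2 * (6 * E ^ 4) := by gcongr
      _ ≤ (a * E) ^ 2 * (6 * E ^ 4) := by
          have : 0 ≤ E - 1 := by linarith
          gcongr
      _ = 6 * a ^ 2 * E ^ 6 := by ring
      _ ≤ 6 * (V * h) ^ 2 * (Real.exp V) ^ 6 := by gcongr
      _ = 6 * V ^ 2 * Real.exp (6 * V) * h ^ 2 := by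
          rw [← Real.exp_nat_mul]; push_cast; ring
  have hsi : s⁻¹ * h ^ 2 = h * s := by
    rw [← hss]; field_simp
  calc _ ≤ _ := hle
    _ ≤ (s * (V * Real.exp V * h) + s⁻¹ * (6 * V ^ 2 * Real.exp (6 * V) * h ^ 2)) / 2 := by gcongr
    _ = (V * Real.exp V + 6 * V ^ 2 * Real.exp (6 * V)) * (h * s) / 2 := by
        rw [show s⁻¹ * (6 * V ^ 2 * Real.exp (6 * V) * h ^ 2)
          = 6 * V ^ 2 * Real.exp (6 * V) * (s⁻¹ * h ^ 2) by ring, hsi]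
        ring
    _ ≤ _ := half_le_self (by positivity)

/-- Power-mean inequality with arbitrary nonnegative weights, for cubes. -/
lemma sum_mul_cube_le {κ : Type*} [Fintype κ] (p x : κ → ℝ) (hp : ∀ i, 0 ≤ p i)
    (hx : ∀ i, 0 ≤ x i) :
    (∑ i, p i * x i) ^ 3 ≤ (∑ i, p i) ^ 2 * ∑ i, p i * x i ^ 3 := by
  rcases (Finset.sum_nonneg fun i _ ↦ hp i : 0 ≤ ∑ i, p i).eq_or_lt with h | h
  · have : ∀ i, p i = 0 := fun i ↦
      (Finset.sum_eq_zero_iff_of_nonneg fun i _ ↦ hp i).1 h.symm i (Finset.mem_univ i)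
    simp [this]
  · have := (convexOn_pow 3).map_sum_le (t := Finset.univ) (w := fun i ↦ p i / ∑ i, p i) (p := x)
      (fun i _ ↦ div_nonneg (hp i) h.le) (by rw [← Finset.sum_div, div_self h.ne'])
      (fun i _ ↦ hx i)
    simp only [smul_eq_mul, div_mul_eq_mul_div, ← Finset.sum_div] at this
    rw [div_pow, div_le_div_iff₀ (by positivity) h] at this
    have h3 : (∑ i, p i) * (∑ i, p i * x i) ^ 3
        ≤ (∑ i, p i) * ((∑ i, p i) ^ 2 * ∑ i, p i * x i ^ 3) := by linarith
    exact le_of_mul_le_mul_left h3 h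

lemma integrable_wickSum_cube {A : Matrix ι ι ℝ} (hA : A.PosSemidef) {p : ι → ℝ}
    (hp : ∀ i, 0 ≤ p i) {V : ℝ} (hV : ∀ i, A i i ≤ V) :
    Integrable (fun z ↦ wickSum p A z ^ 3) (multivariateGaussian 0 A) ∧
      ∫ z, wickSum p A z ^ 3 ∂(multivariateGaussian 0 A) ≤ (∑ i, p i) ^ 3 * Real.exp (3 * V) := by
  set μ := multivariateGaussian 0 A
  have hm : ∀ i, Integrable (fun z : EuclideanSpace ℝ ι ↦ Real.exp (z i - A i i / 2) ^ 3) μ ∧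
      ∫ z, Real.exp (z i - A i i / 2) ^ 3 ∂μ ≤ Real.exp (3 * V) := by
    intro i
    have := multivariateGaussian_exp_mul_sub hA i 3 (3 * (A i i / 2))
    have hz : ∀ z : EuclideanSpace ℝ ι,
        Real.exp (3 * z i - 3 * (A i i / 2)) = Real.exp (z i - A i i / 2) ^ 3 := by
      intro z
      rw [← Real.exp_nat_mul]
      push_cast
      ring_nf
    simp only [hz] at this
    refine ⟨this.1, this.2.trans_le (Real.exp_le_exp.2 ?_)⟩
    linarith [hV i]
  have hint : Integrable (fun z : EuclideanSpace ℝ ι ↦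
      (∑ i, p i) ^ 2 * ∑ i, p i * Real.exp (z i - A i i / 2) ^ 3) μ :=
    (integrable_finsetSum _ fun i _ ↦ (hm i).1.const_mul (p i)).const_mul _
  have hpt : ∀ z : EuclideanSpace ℝ ι, wickSum p A z ^ 3
      ≤ (∑ i, p i) ^ 2 * ∑ i, p i * Real.exp (z i - A i i / 2) ^ 3 := fun z ↦
    sum_mul_cube_le p _ hp fun i ↦ (Real.exp_pos _).le
  have h0 : ∀ z, 0 ≤ wickSum p A z := fun z ↦
    Finset.sum_nonneg fun i _ ↦ mul_nonneg (hp i) (Real.exp_pos _).le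
  have hint' : Integrable (fun z ↦ wickSum p A z ^ 3) μ := by
    refine hint.mono' (by fun_prop) (.of_forall fun z ↦ ?_)
    rw [Real.norm_eq_abs, abs_of_nonneg (pow_nonneg (h0 z) 3)]
    exact hpt z
  refine ⟨hint', (integral_mono hint' hint hpt).trans ?_⟩
  rw [integral_const_mul, integral_finsetSum _ fun i _ ↦ (hm i).1.const_mul (p i)]
  simp only [integral_const_mul]
  calc _ ≤ (∑ i, p i) ^ 2 * ∑ i, p i * Real.exp (3 * V) := by
        gcongr with i _
        · exact hp i
        · exact (hm i).2
    _ = _ := by rw [← Finset.sum_mul]; ring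

/-- Second-order expansion of `E[g(wickSum q A)]` for a small covariance `A`. -/
lemma abs_integral_comp_wickSum_sub_le {g g₁ g₂ : ℝ → ℝ} {L : ℝ}
    (h₁ : ∀ x, HasDerivAt g (g₁ x) x) (h₂ : ∀ x, HasDerivAt g₁ (g₂ x) x)
    (hL : ∀ x y, |g₂ x - g₂ y| ≤ L * |x - y|) {A : Matrix ι ι ℝ} (hA : A.PosSemidef)
    {q : ι → ℝ} (hq : ∀ i, 0 ≤ q i) {V h : ℝ} (hh : 0 < h) (hh1 : h ≤ 1)
    (hV : ∀ i, A i i ≤ V * h) :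
    Integrable (fun z ↦ g (wickSum q A z)) (multivariateGaussian 0 A) ∧
      |∫ z, g (wickSum q A z) ∂(multivariateGaussian 0 A) - g (∑ i, q i)
        - g₂ (∑ i, q i) / 2 * ∑ i, ∑ j, q i * q j * (Real.exp (A i j) - 1)|
        ≤ L * (∑ i, q i) ^ 3 *
          ((V * Real.exp V + 6 * V ^ 2 * Real.exp (6 * V)) * (h * √h)) := by
  set μ := multivariateGaussian 0 A
  set S := ∑ i, q i with hS
  set C := (V * Real.exp V + 6 * V ^ 2 * Real.exp (6 * V)) * (h * √h)
  have hL0 : 0 ≤ L := by simpa using (abs_nonneg _).trans (hL 1 0)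
  have hS0 : 0 ≤ S := Finset.sum_nonneg fun i _ ↦ hq i
  have hgc : Continuous g := continuous_iff_continuousAt.2 fun x ↦ (h₁ x).continuousAt
  have hW : ∀ z : EuclideanSpace ℝ ι,
      wickSum q A z - S = ∑ i, q i * (Real.exp (z i - A i i / 2) - 1) := by
    intro z
    simp [wickSum, hS, mul_sub, Finset.sum_sub_distrib]
  have hexp : ∀ i, Integrable (fun z : EuclideanSpace ℝ ι ↦ Real.exp (z i - A i i / 2) - 1) μ ∧
      ∫ z, (Real.exp (z i - A i i / 2) - 1) ∂μ = 0 := by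
    intro i
    have := multivariateGaussian_exp_mul_sub hA i 1 (A i i / 2)
    simp only [one_mul] at this
    refine ⟨this.1.sub' (integrable_const 1), ?_⟩
    rw [integral_sub this.1 (integrable_const 1), this.2]
    simp
  have hexp2 : ∀ i j, Integrable (fun z : EuclideanSpace ℝ ι ↦
        (Real.exp (z i - A i i / 2) - 1) * (Real.exp (z j - A j j / 2) - 1)) μ ∧
      ∫ z, (Real.exp (z i - A i i / 2) - 1) * (Real.exp (z j - A j j / 2) - 1) ∂μ
        = Real.exp (A i j) - 1 := by
    intro i j
    have h12 := multivariateGaussian_exp_add_sub hA i j (A i i / 2 + A j j / 2)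
    have hz : ∀ z : EuclideanSpace ℝ ι,
        (Real.exp (z i - A i i / 2) - 1) * (Real.exp (z j - A j j / 2) - 1) =
        (Real.exp (z i + z j - (A i i / 2 + A j j / 2)) - 1)
          - ((Real.exp (z i - A i i / 2) - 1) + (Real.exp (z j - A j j / 2) - 1)) := by
      intro z
      rw [show z i + z j - (A i i / 2 + A j j / 2)
        = (z i - A i i / 2) + (z j - A j j / 2) by ring, Real.exp_add]
      ring
    simp only [hz]
    have k1 := h12.1.sub' (integrable_const (1 : ℝ))
    have k2 := (hexp i).1.fun_add (hexp j).1
    refine ⟨k1.sub' k2, ?_⟩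
    rw [integral_sub k1 k2, integral_sub h12.1 (integrable_const 1),
      integral_add (hexp i).1 (hexp j).1, (hexp i).2, (hexp j).2, h12.2]
    simp
  have hlin : Integrable (fun z ↦ wickSum q A z - S) μ ∧ ∫ z, (wickSum q A z - S) ∂μ = 0 := by
    simp only [hW]
    refine ⟨integrable_finsetSum _ fun i _ ↦ (hexp i).1.const_mul _, ?_⟩
    rw [integral_finsetSum _ fun i _ ↦ (hexp i).1.const_mul _]
    simp only [integral_const_mul, (hexp _).2, mul_zero, Finset.sum_const_zero]
  have hquad : Integrable (fun z ↦ (wickSum q A z - S) ^ 2) μ ∧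
      ∫ z, (wickSum q A z - S) ^ 2 ∂μ = ∑ i, ∑ j, q i * q j * (Real.exp (A i j) - 1) := by
    have hz : ∀ z, (wickSum q A z - S) ^ 2 = ∑ i, ∑ j, q i * q j *
        ((Real.exp (z i - A i i / 2) - 1) * (Real.exp (z j - A j j / 2) - 1)) := by
      intro z
      rw [hW, sq, Finset.sum_mul_sum]
      exact Finset.sum_congr rfl fun i _ ↦ Finset.sum_congr rfl fun j _ ↦ by ring
    simp only [hz]
    refine ⟨integrable_finsetSum _ fun i _ ↦ integrable_finsetSum _ fun j _ ↦
      (hexp2 i j).1.const_mul _, ?_⟩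
    rw [integral_finsetSum _ fun i _ ↦ integrable_finsetSum _ fun j _ ↦
      (hexp2 i j).1.const_mul _]
    refine Finset.sum_congr rfl fun i _ ↦ ?_
    rw [integral_finsetSum _ fun j _ ↦ (hexp2 i j).1.const_mul _]
    simp only [integral_const_mul, (hexp2 _ _).2]
  have hcube0 := fun i ↦ integral_abs_exp_sub_one_cube_le hA i hh hh1 (hV i)
  have hbd : Integrable (fun z : EuclideanSpace ℝ ι ↦
      S ^ 2 * ∑ i, q i * |Real.exp (z i - A i i / 2) - 1| ^ 3) μ :=
    (integrable_finsetSum _ fun i _ ↦ (hcube0 i).1.const_mul (q i)).const_mul _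
  have hcpt : ∀ z, |wickSum q A z - S| ^ 3
      ≤ S ^ 2 * ∑ i, q i * |Real.exp (z i - A i i / 2) - 1| ^ 3 := by
    intro z
    have : |wickSum q A z - S| ≤ ∑ i, q i * |Real.exp (z i - A i i / 2) - 1| := by
      rw [hW]
      refine (Finset.abs_sum_le_sum_abs _ _).trans_eq (Finset.sum_congr rfl fun i _ ↦ ?_)
      rw [abs_mul, abs_of_nonneg (hq i)]
    calc _ ≤ (∑ i, q i * |Real.exp (z i - A i i / 2) - 1|) ^ 3 := by gcongr
      _ ≤ _ := sum_mul_cube_le q _ hq fun i ↦ abs_nonneg _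
  have hcube : Integrable (fun z ↦ |wickSum q A z - S| ^ 3) μ := by
    refine hbd.mono' (by fun_prop) (.of_forall fun z ↦ ?_)
    rw [Real.norm_eq_abs, abs_of_nonneg (by positivity)]
    exact hcpt z
  have hcubeI : ∫ z, |wickSum q A z - S| ^ 3 ∂μ ≤ S ^ 3 * C := by
    refine (integral_mono hcube hbd hcpt).trans ?_
    rw [integral_const_mul, integral_finsetSum _ fun i _ ↦ (hcube0 i).1.const_mul (q i)]
    simp only [integral_const_mul]
    calc _ ≤ S ^ 2 * ∑ i, q i * C := by
          gcongr with i _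
          · exact hq i
          · exact (hcube0 i).2
      _ = _ := by rw [← Finset.sum_mul]; ring
  have hT : ∀ z, |g (wickSum q A z) - g S - g₁ S * (wickSum q A z - S)
      - g₂ S / 2 * (wickSum q A z - S) ^ 2| ≤ L * |wickSum q A z - S| ^ 3 := fun z ↦
    abs_taylor_two_le h₁ h₂ hL S _
  have hrem : Integrable (fun z ↦ g (wickSum q A z) - g S - g₁ S * (wickSum q A z - S)
      - g₂ S / 2 * (wickSum q A z - S) ^ 2) μ := by
    refine (hcube.const_mul L).mono' ?_ (.of_forall fun z ↦ hT z)
    exact (by fun_prop : Continuous _).aestronglyMeasurable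
  have hpoly : Integrable (fun z ↦ g S + g₁ S * (wickSum q A z - S)
      + g₂ S / 2 * (wickSum q A z - S) ^ 2) μ :=
    ((integrable_const _).fun_add (hlin.1.const_mul _)).fun_add (hquad.1.const_mul _)
  have hpolyI : ∫ z, (g S + g₁ S * (wickSum q A z - S)
      + g₂ S / 2 * (wickSum q A z - S) ^ 2) ∂μ =
      g S + g₂ S / 2 * ∑ i, ∑ j, q i * q j * (Real.exp (A i j) - 1) := by
    rw [integral_add ((integrable_const _).fun_add (hlin.1.const_mul _)) (hquad.1.const_mul _),
      integral_add (integrable_const _) (hlin.1.const_mul _), integral_const_mul,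
      integral_const_mul, hlin.2, hquad.2]
    simp
  have hg : Integrable (fun z ↦ g (wickSum q A z)) μ :=
    (hrem.fun_add hpoly).congr (.of_forall fun z ↦ by ring)
  refine ⟨hg, ?_⟩
  have e1 : ∫ z, (g (wickSum q A z) - g S - g₁ S * (wickSum q A z - S)
      - g₂ S / 2 * (wickSum q A z - S) ^ 2) ∂μ = ∫ z, g (wickSum q A z) ∂μ - g S
        - g₂ S / 2 * ∑ i, ∑ j, q i * q j * (Real.exp (A i j) - 1) := by
    rw [sub_sub, ← hpolyI, ← integral_sub hg hpoly]
    exact integral_congr_ae (.of_forall fun z ↦ by ring)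
  rw [← e1, ← Real.norm_eq_abs]
  refine (norm_integral_le_of_norm_le (hcube.const_mul L)
    (.of_forall fun z ↦ (Real.norm_eq_abs _).trans_le (hT z))).trans ?_
  rw [integral_const_mul]
  calc _ ≤ L * (S ^ 3 * C) := by gcongr
    _ = _ := by ring

lemma multivariateGaussian_conv {A B : Matrix ι ι ℝ} (hA : A.PosSemidef) (hB : B.PosSemidef) :
    multivariateGaussian 0 A ∗ multivariateGaussian 0 B = multivariateGaussian 0 (A + B) := by
  refine Measure.ext_of_charFun ?_
  ext t
  rw [charFun_conv, charFun_multivariateGaussian hA, charFun_multivariateGaussian hB,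
    charFun_multivariateGaussian (hA.add hB), ← Complex.exp_add]
  congr 1
  rw [Matrix.add_mulVec, dotProduct_add]
  push_cast
  simp
  ring

/-- Comparison of two covariances which differ by a small increment. -/
lemma integral_comp_wickSum_add_sub_ge {g g₁ g₂ : ℝ → ℝ} {L : ℝ}
    (h₁ : ∀ x, HasDerivAt g (g₁ x) x) (h₂ : ∀ x, HasDerivAt g₁ (g₂ x) x)
    (hL : ∀ x y, |g₂ x - g₂ y| ≤ L * |x - y|) (h₀ : ∀ x, 0 ≤ g₂ x)
    {R A B : Matrix ι ι ℝ} (hR : R.PosSemidef) (hA : A.PosSemidef) (hB : B.PosSemidef)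
    (hAB : ∀ i j, A i j ≤ B i j)
    {p : ι → ℝ} (hp : ∀ i, 0 ≤ p i) {V h : ℝ} (hV0 : 0 ≤ V) (hh : 0 < h)
    (hh1 : h ≤ 1) (hVR : ∀ i, R i i ≤ V) (hV : ∀ i, B i i ≤ V * h) :
    -(2 * L * (∑ i, p i) ^ 3 * Real.exp (3 * V) *
        ((V * Real.exp V + 6 * V ^ 2 * Real.exp (6 * V)) * (h * √h))) ≤
      ∫ z, g (wickSum p (R + B) z) ∂(multivariateGaussian 0 (R + B)) -
        ∫ z, g (wickSum p (R + A) z) ∂(multivariateGaussian 0 (R + A)) := by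
  have hL0 : 0 ≤ L := by simpa using (abs_nonneg _).trans (hL 1 0)
  set C := (V * Real.exp V + 6 * V ^ 2 * Real.exp (6 * V)) * (h * √h) with hC
  have hVA : ∀ i, A i i ≤ V * h := fun i ↦ (hAB i i).trans (hV i)
  set q : EuclideanSpace ℝ ι → ι → ℝ := fun x i ↦ p i * Real.exp (x i - R i i / 2) with hqdef
  have hq : ∀ x i, 0 ≤ q x i := fun x i ↦ mul_nonneg (hp i) (Real.exp_pos _).le
  have hsplit : ∀ (M : Matrix ι ι ℝ) (x y : EuclideanSpace ℝ ι),
      wickSum p (R + M) (x + y) = wickSum (q x) M y := by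
    intro M x y
    refine Finset.sum_congr rfl fun i _ ↦ ?_
    rw [hqdef]
    simp only [PiLp.add_apply, Matrix.add_apply]
    rw [mul_assoc, ← Real.exp_add]
    ring_nf
  have hgc : Continuous g := continuous_iff_continuousAt.2 fun x ↦ (h₁ x).continuousAt
  have hcond : ∀ (M : Matrix ι ι ℝ), M.PosSemidef →
      Integrable (fun z ↦ g (wickSum p (R + M) z)) (multivariateGaussian 0 (R + M)) := by
    intro M hM
    obtain ⟨U, hU⟩ := (Set.finite_range fun i ↦ (R + M) i i).bddAbove
    exact (abs_integral_comp_wickSum_sub_le h₁ h₂ hL (hR.add hM) hp one_pos le_rfl (V := U)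
      fun i ↦ by simpa using hU (Set.mem_range_self i)).1
  have hconv : ∀ (M : Matrix ι ι ℝ), M.PosSemidef →
      Integrable (fun x ↦ ∫ y, g (wickSum (q x) M y) ∂(multivariateGaussian 0 M))
        (multivariateGaussian 0 R) ∧
      ∫ z, g (wickSum p (R + M) z) ∂(multivariateGaussian 0 (R + M)) =
        ∫ x, ∫ y, g (wickSum (q x) M y) ∂(multivariateGaussian 0 M)
          ∂(multivariateGaussian 0 R) := by
    intro M hM
    have hi := hcond M hM
    rw [← multivariateGaussian_conv hR hM] at hi ⊢
    have := integral_conv hi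
    simp only [hsplit] at this
    refine ⟨?_, this⟩
    have h3 := (integrable_map_measure hi.1 (by fun_prop)).1 hi
    have h4 := h3.integral_prod_left
    simpa [Function.comp_def, hsplit] using h4
  rw [(hconv A hA).2, (hconv B hB).2, ← integral_sub (hconv B hB).1 (hconv A hA).1]
  obtain ⟨hS3, hS3le⟩ := integrable_wickSum_cube hR hp hVR
  have hC0 : 0 ≤ 2 * L * C := by positivity
  have hle : ∫ x, -(2 * L * C) * wickSum p R x ^ 3 ∂(multivariateGaussian 0 R) ≤
      ∫ x, (∫ y, g (wickSum (q x) B y) ∂(multivariateGaussian 0 B) -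
        ∫ y, g (wickSum (q x) A y) ∂(multivariateGaussian 0 A)) ∂(multivariateGaussian 0 R) := by
    refine integral_mono (hS3.const_mul _) ((hconv B hB).1.sub' (hconv A hA).1) fun x ↦ ?_
    have eA := abs_le.1
      (abs_integral_comp_wickSum_sub_le h₁ h₂ hL hA (hq x) hh hh1 hVA).2
    have eB := abs_le.1
      (abs_integral_comp_wickSum_sub_le h₁ h₂ hL hB (hq x) hh hh1 hV).2
    have hmono : g₂ (∑ i, q x i) / 2 * ∑ i, ∑ j, q x i * q x j * (Real.exp (A i j) - 1) ≤
        g₂ (∑ i, q x i) / 2 * ∑ i, ∑ j, q x i * q x j * (Real.exp (B i j) - 1) := by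
      have := h₀ (∑ i, q x i)
      gcongr with i _ j _
      · exact mul_nonneg (hq x i) (hq x j)
      · exact hAB i j
    have hw : wickSum p R x = ∑ i, q x i := rfl
    simp only [hw]
    linarith [eA.2, eB.1]
  rw [integral_const_mul] at hle
  refine le_trans ?_ hle
  have := mul_le_mul_of_nonneg_left hS3le hC0
  linarith

/-- The convexity inequality for finite sums and smooth convex functions. -/
lemma integral_comp_wickSum_le_of_smooth {g g₁ g₂ : ℝ → ℝ} {L : ℝ}
    (h₁ : ∀ x, HasDerivAt g (g₁ x) x) (h₂ : ∀ x, HasDerivAt g₁ (g₂ x) x)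
    (hL : ∀ x y, |g₂ x - g₂ y| ≤ L * |x - y|) (h₀ : ∀ x, 0 ≤ g₂ x)
    {A B : Matrix ι ι ℝ} (hA : A.PosSemidef) (hB : B.PosSemidef)
    (hAB : ∀ i j, A i j ≤ B i j) {p : ι → ℝ} (hp : ∀ i, 0 ≤ p i) :
    ∫ z, g (wickSum p A z) ∂(multivariateGaussian 0 A) ≤
      ∫ z, g (wickSum p B z) ∂(multivariateGaussian 0 B) := by
  obtain ⟨U, hU⟩ := (Set.finite_range fun i ↦ B i i).bddAbove
  set V := max U 0
  have hV0 : 0 ≤ V := le_max_right _ _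
  have hVB : ∀ i, B i i ≤ V := fun i ↦ (hU (Set.mem_range_self i)).trans (le_max_left _ _)
  set φ : Matrix ι ι ℝ → ℝ :=
    fun M ↦ ∫ z, g (wickSum p M z) ∂(multivariateGaussian 0 M) with hφ
  set C := 2 * L * (∑ i, p i) ^ 3 * Real.exp (3 * V) *
    (V * Real.exp V + 6 * V ^ 2 * Real.exp (6 * V)) with hC
  have key : ∀ n : ℕ, -(C * √(1 / ((n : ℝ) + 1))) ≤ φ B - φ A := by
    intro n
    set h : ℝ := 1 / ((n : ℝ) + 1) with hh
    have hn : (0 : ℝ) < n + 1 := by positivity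
    have hh0 : 0 < h := by positivity
    have hh1 : h ≤ 1 := by
      rw [hh, div_le_one hn]
      linarith [Nat.cast_nonneg (α := ℝ) n]
    set K : ℕ → Matrix ι ι ℝ := fun k ↦ (1 - k * h) • A + (k * h) • B with hK
    have hstep : ∀ k ∈ Finset.range (n + 1), -(C * (h * √h)) ≤ φ (K (k + 1)) - φ (K k) := by
      intro k hk
      have hk' : ((k : ℝ) + 1) * h ≤ 1 := by
        rw [hh, mul_one_div, div_le_one hn]
        have := Finset.mem_range.1 hk
        exact_mod_cast this
      set R := (1 - (k + 1) * h) • A + (k * h) • B with hR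
      have e1 : K k = R + h • A := by
        ext i j
        simp [hK, hR]
        ring
      have e2 : K (k + 1) = R + h • B := by
        ext i j
        simp [hK, hR]
        ring
      have hRp : R.PosSemidef := (hA.smul (by linarith)).add (hB.smul (by positivity))
      have := integral_comp_wickSum_add_sub_ge h₁ h₂ hL h₀ hRp (hA.smul hh0.le)
        (hB.smul hh0.le) (fun i j ↦ mul_le_mul_of_nonneg_left (hAB i j) hh0.le) hp hV0 hh0 hh1
        (fun i ↦ ?_) (fun i ↦ ?_)
      · rw [e1, e2]
        refine le_trans (le_of_eq ?_) this
        rw [hC]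
        ring
      · have a1 : A i i ≤ V := (hAB i i).trans (hVB i)
        have a2 := hVB i
        have a3 : 0 ≤ k * h := by positivity
        simp only [hR, Matrix.add_apply, Matrix.smul_apply, smul_eq_mul]
        nlinarith
      · simp only [Matrix.smul_apply, smul_eq_mul]
        nlinarith [hVB i]
    have hsum := Finset.sum_le_sum hstep
    rw [Finset.sum_range_sub (fun k ↦ φ (K k))] at hsum
    have hK0 : K 0 = A := by simp [hK]
    have hK1 : K (n + 1) = B := by
      have : ((n : ℝ) + 1) * h = 1 := by rw [hh]; field_simp
      simp [hK, this]
    rw [hK0, hK1] at hsum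
    refine le_trans (le_of_eq ?_) hsum
    have : ((n : ℝ) + 1) * h = 1 := by rw [hh]; field_simp
    simp only [Finset.sum_const, Finset.card_range, nsmul_eq_mul]
    push_cast
    linear_combination C * √h * this
  have hlim : Tendsto (fun n : ℕ ↦ -(C * √(1 / ((n : ℝ) + 1)))) atTop (𝓝 0) := by
    have := (Real.continuous_sqrt.tendsto 0).comp (tendsto_one_div_add_atTop_nhds_zero_nat (𝕜 := ℝ))
    simpa using (this.const_mul C).neg
  linarith [le_of_tendsto' hlim key]

lemma integrable_wickSum {A : Matrix ι ι ℝ} (hA : A.PosSemidef) (p : ι → ℝ) :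
    Integrable (wickSum p A) (multivariateGaussian 0 A) := by
  refine integrable_finsetSum _ fun i _ ↦ Integrable.const_mul ?_ _
  simpa using (multivariateGaussian_exp_mul_sub hA i 1 (A i i / 2)).1

lemma _root_.LipschitzWith.integrable_comp {α : Type*} {m : MeasurableSpace α} {μ : Measure α}
    [IsFiniteMeasure μ] {F : ℝ → ℝ} {K : ℝ≥0} (hK : LipschitzWith K F) {f : α → ℝ}
    (hf : Integrable f μ) : Integrable (fun x ↦ F (f x)) μ := by
  refine ((integrable_const |F 0|).add (hf.abs.const_mul (K : ℝ))).mono'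
    (hK.continuous.comp_aestronglyMeasurable hf.1) (.of_forall fun x ↦ ?_)
  have := hK.dist_le_mul (f x) 0
  simp only [Real.dist_eq, sub_zero] at this
  have h2 := abs_sub_abs_le_abs_sub (F (f x)) (F 0)
  simp only [Pi.add_apply, Real.norm_eq_abs]
  linarith

/-- The convexity inequality for finite sums and Lipschitz convex functions. -/
lemma integral_comp_wickSum_le_of_lipschitz {F : ℝ → ℝ} (hF : ConvexOn ℝ Set.univ F) {K : ℝ≥0}
    (hK : LipschitzWith K F) {A B : Matrix ι ι ℝ} (hA : A.PosSemidef) (hB : B.PosSemidef)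
    (hAB : ∀ i j, A i j ≤ B i j) {p : ι → ℝ} (hp : ∀ i, 0 ≤ p i) :
    ∫ z, F (wickSum p A z) ∂(multivariateGaussian 0 A) ≤
      ∫ z, F (wickSum p B z) ∂(multivariateGaussian 0 B) := by
  refine le_of_forall_pos_le_add fun δ hδ ↦ ?_
  set ε := δ / (20 * (K + 1)) with hε
  have hε0 : 0 < ε := by positivity
  have hεK : 20 * K * ε ≤ δ := by
    rw [hε, mul_div_assoc', div_le_iff₀ (by positivity)]
    nlinarith
  obtain ⟨g, g₁, g₂, L, h₁, h₂, hL, h₀, hg⟩ := exists_smooth_approx_of_convex hF hK hε0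
  have hgc : Continuous g := continuous_iff_continuousAt.2 fun x ↦ (h₁ x).continuousAt
  have hclose : ∀ {M : Matrix ι ι ℝ}, M.PosSemidef →
      |∫ z, g (wickSum p M z) ∂(multivariateGaussian 0 M) -
        ∫ z, F (wickSum p M z) ∂(multivariateGaussian 0 M)| ≤ 10 * K * ε := by
    intro M hM
    have iF := hK.integrable_comp (integrable_wickSum hM p)
    have ib : Integrable (fun z ↦ g (wickSum p M z) - F (wickSum p M z))
        (multivariateGaussian 0 M) := by
      refine (integrable_const (10 * K * ε)).mono' ?_ (.of_forall fun z ↦ hg _)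
      have := hK.continuous
      exact (by fun_prop : Continuous _).aestronglyMeasurable
    have ig : Integrable (fun z ↦ g (wickSum p M z)) (multivariateGaussian 0 M) :=
      (ib.fun_add iF).congr (.of_forall fun z ↦ by simp)
    rw [← integral_sub ig iF, ← Real.norm_eq_abs]
    refine (norm_integral_le_of_norm_le_const (.of_forall fun z ↦ hg _)).trans_eq ?_
    simp
  have e1 := abs_le.1 (hclose hA)
  have e2 := abs_le.1 (hclose hB)
  have e3 := integral_comp_wickSum_le_of_smooth h₁ h₂ hL h₀ hA hB hAB hp
  linarith [e1.1, e2.2]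

end FiniteDimensional

section GaussianFamily

variable {D Ω : Type*} {mΩ : MeasurableSpace Ω}

/-- Every finite linear combination of the random variables `Y x` is a centered Gaussian. -/
def IsCenteredGaussian (P : Measure Ω) (Y : D → Ω → ℝ) : Prop :=
  ∀ (n : ℕ) (x : Fin n → D) (l : Fin n → ℝ), ∃ v : ℝ≥0,
    Measure.map (fun ω ↦ ∑ i, l i * Y (x i) ω) P = gaussianReal 0 v

/-- The Wick exponential of a centered process. -/
noncomputable def wickExp (P : Measure Ω) (Y : D → Ω → ℝ) (x : D) (ω : Ω) : ℝ :=
  Real.exp (Y x ω - (∫ ω', Y x ω' ^ 2 ∂P) / 2)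

lemma integral_sq_of_map_eq_gaussianReal {P : Measure Ω} {X : Ω → ℝ} (hX : Measurable X) {v : ℝ≥0}
    (h : P.map X = gaussianReal 0 v) : MemLp X 2 P ∧ ∫ ω, X ω ^ 2 ∂P = v := by
  have h1 : MemLp (id : ℝ → ℝ) 2 (P.map X) := by
    rw [h]
    exact memLp_id_gaussianReal 2
  have h2 : MemLp X 2 P := (memLp_map_measure_iff h1.1 hX.aemeasurable).1 h1
  refine ⟨h2, ?_⟩
  have h3 := variance_id_gaussianReal (μ := 0) (v := v)
  rw [variance_of_integral_eq_zero aemeasurable_id (by simp), ← h,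
    integral_map hX.aemeasurable (by fun_prop)] at h3
  simpa using h3

variable {P : Measure Ω} {Y : D → Ω → ℝ}

lemma IsCenteredGaussian.map_eq (h : IsCenteredGaussian P Y) (hm : ∀ x, Measurable (Y x)) (x : D) :
    P.map (Y x) = gaussianReal 0 (∫ ω, Y x ω ^ 2 ∂P).toNNReal := by
  obtain ⟨v, hv⟩ := h 1 (fun _ ↦ x) (fun _ ↦ 1)
  simp only [Finset.univ_unique, Finset.sum_singleton, one_mul] at hv
  rw [(integral_sq_of_map_eq_gaussianReal (hm x) hv).2, hv]
  simp

lemma IsCenteredGaussian.memLp (h : IsCenteredGaussian P Y) (hm : ∀ x, Measurable (Y x)) (x : D) :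
    MemLp (Y x) 2 P :=
  (integral_sq_of_map_eq_gaussianReal (hm x) (h.map_eq hm x)).1

/-- The covariance matrix of finitely many random variables of the family. -/
noncomputable def covMatrix (P : Measure Ω) (Y : D → Ω → ℝ) {n : ℕ} (x : Fin n → D) :
    Matrix (Fin n) (Fin n) ℝ :=
  .of fun i j ↦ ∫ ω, Y (x i) ω * Y (x j) ω ∂P

lemma IsCenteredGaussian.integral_sum_sq (h : IsCenteredGaussian P Y) (hm : ∀ x, Measurable (Y x))
    {n : ℕ} (x : Fin n → D) (l : Fin n → ℝ) :
    ∫ ω, (∑ i, l i * Y (x i) ω) ^ 2 ∂P = l ⬝ᵥ (covMatrix P Y x).mulVec l := by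
  have hint : ∀ i j, Integrable (fun ω ↦ l i * l j * (Y (x i) ω * Y (x j) ω)) P := fun i j ↦
    ((h.memLp hm (x i)).integrable_mul (h.memLp hm (x j))).const_mul _
  have hz : ∀ ω, (∑ i, l i * Y (x i) ω) ^ 2 = ∑ i, ∑ j, l i * l j * (Y (x i) ω * Y (x j) ω) := by
    intro ω
    rw [sq, Finset.sum_mul_sum]
    exact Finset.sum_congr rfl fun i _ ↦ Finset.sum_congr rfl fun j _ ↦ by ring
  simp only [hz]
  rw [integral_finsetSum _ fun i _ ↦ integrable_finsetSum _ fun j _ ↦ hint i j]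
  simp only [dotProduct, Matrix.mulVec, Finset.mul_sum]
  refine Finset.sum_congr rfl fun i _ ↦ ?_
  rw [integral_finsetSum _ fun j _ ↦ hint i j]
  refine Finset.sum_congr rfl fun j _ ↦ ?_
  rw [integral_const_mul]
  simp only [covMatrix, Matrix.of_apply]
  ring

lemma IsCenteredGaussian.posSemidef_covMatrix (h : IsCenteredGaussian P Y)
    (hm : ∀ x, Measurable (Y x)) {n : ℕ} (x : Fin n → D) : (covMatrix P Y x).PosSemidef := by
  refine Matrix.PosSemidef.of_dotProduct_mulVec_nonneg ?_ fun l ↦ ?_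
  · ext i j
    simp [covMatrix, mul_comm]
  · rw [star_trivial, ← h.integral_sum_sq hm x l]
    exact integral_nonneg fun ω ↦ sq_nonneg _

lemma IsCenteredGaussian.map_toLp [IsProbabilityMeasure P] (h : IsCenteredGaussian P Y)
    (hm : ∀ x, Measurable (Y x)) {n : ℕ} (x : Fin n → D) :
    P.map (fun ω ↦ WithLp.toLp 2 fun i ↦ Y (x i) ω) =
      multivariateGaussian 0 (covMatrix P Y x) := by
  have hmeas : Measurable fun ω ↦ WithLp.toLp 2 fun i ↦ Y (x i) ω := by fun_prop
  have : IsProbabilityMeasure (P.map fun ω ↦ WithLp.toLp 2 fun i ↦ Y (x i) ω) :=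
    Measure.isProbabilityMeasure_map hmeas.aemeasurable
  refine Measure.ext_of_charFun ?_
  ext t
  rw [charFun_multivariateGaussian (h.posSemidef_covMatrix hm x), charFun_apply,
    integral_map hmeas.aemeasurable (by fun_prop)]
  obtain ⟨v, hv⟩ := h n x t.ofLp
  have hms : Measurable fun ω ↦ ∑ i, t.ofLp i * Y (x i) ω := by fun_prop
  have h1 := charFun_gaussianReal (μ := 0) (v := v) 1
  rw [← hv, charFun_apply, integral_map hms.aemeasurable (by fun_prop),
    ← (integral_sq_of_map_eq_gaussianReal hms hv).2, h.integral_sum_sq hm] at h1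
  simp only [PiLp.inner_apply] at h1 ⊢
  convert h1 using 2
  · simp
  · simp

lemma wickExp_pos (x : D) (ω : Ω) : 0 < wickExp P Y x ω := Real.exp_pos _

lemma IsCenteredGaussian.wickExp_pow (h : IsCenteredGaussian P Y) (hm : ∀ x, Measurable (Y x))
    (x : D) (n : ℕ) : Integrable (fun ω ↦ wickExp P Y x ω ^ n) P ∧
      ∫ ω, wickExp P Y x ω ^ n ∂P =
        Real.exp (((n : ℝ) ^ 2 - n) / 2 * ∫ ω, Y x ω ^ 2 ∂P) := by
  set v := ∫ ω, Y x ω ^ 2 ∂P with hv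
  have hv0 : 0 ≤ v := integral_nonneg fun ω ↦ sq_nonneg _
  have hmgf := mgf_gaussianReal (h.map_eq hm x) n
  simp only [mgf, ← hv, Real.coe_toNNReal _ hv0] at hmgf
  have hz : ∀ ω, wickExp P Y x ω ^ n = Real.exp (n * Y x ω) * Real.exp (-(n * (v / 2))) := by
    intro ω
    rw [wickExp, ← hv, ← Real.exp_nat_mul, ← Real.exp_add]
    ring_nf
  have hint : Integrable (fun ω ↦ Real.exp (n * Y x ω)) P := by
    by_contra hc
    rw [integral_undef hc] at hmgf
    exact (Real.exp_pos _).ne hmgf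
  simp only [hz]
  refine ⟨hint.mul_const _, ?_⟩
  rw [integral_mul_const, hmgf, ← Real.exp_add]
  ring_nf

lemma IsCenteredGaussian.integral_wickExp (h : IsCenteredGaussian P Y)
    (hm : ∀ x, Measurable (Y x)) (x : D) : ∫ ω, wickExp P Y x ω ∂P = 1 := by
  simpa using (h.wickExp_pow hm x 1).2

lemma IsCenteredGaussian.continuous_integral_sq [TopologicalSpace D] [FirstCountableTopology D]
    [IsProbabilityMeasure P] (h : IsCenteredGaussian P Y) (hm : ∀ x, Measurable (Y x))
    (hc : ∀ ω, Continuous fun x ↦ Y x ω) : Continuous fun x ↦ ∫ ω, Y x ω ^ 2 ∂P := by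
  have h1 : Continuous fun x ↦ ∫ ω, Complex.exp (Y x ω * Complex.I) ∂P := by
    refine continuous_of_dominated (bound := fun _ ↦ 1)
      (fun x ↦ (by fun_prop : Measurable _).aestronglyMeasurable)
      (fun x ↦ .of_forall fun ω ↦ ?_) (integrable_const _) (.of_forall fun ω ↦ ?_)
    · rw [Complex.norm_exp_ofReal_mul_I]
    · have := hc ω
      fun_prop
  have h2 : ∀ x, ∫ ω, Y x ω ^ 2 ∂P =
      -2 * Real.log ‖∫ ω, Complex.exp (Y x ω * Complex.I) ∂P‖ := by
    intro x
    have h3 := charFun_gaussianReal (μ := 0) (v := (∫ ω, Y x ω ^ 2 ∂P).toNNReal) 1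
    rw [← h.map_eq hm x, charFun_apply_real, integral_map (hm x).aemeasurable (by fun_prop),
      Real.coe_toNNReal _ (integral_nonneg fun ω ↦ sq_nonneg _)] at h3
    simp only [Complex.ofReal_one, one_mul] at h3
    rw [h3, Complex.norm_exp]
    simp
    ring
  simp only [h2]
  refine continuous_const.mul (h1.norm.log fun x hx ↦ ?_)
  have h3 := charFun_gaussianReal (μ := 0) (v := (∫ ω, Y x ω ^ 2 ∂P).toNNReal) 1
  rw [← h.map_eq hm x, charFun_apply_real, integral_map (hm x).aemeasurable (by fun_prop)] at h3
  simp only [Complex.ofReal_one, one_mul] at h3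
  rw [h3, norm_eq_zero] at hx
  exact Complex.exp_ne_zero _ hx

lemma IsCenteredGaussian.continuous_wickExp [TopologicalSpace D]
    [FirstCountableTopology D] [IsProbabilityMeasure P] (h : IsCenteredGaussian P Y)
    (hm : ∀ x, Measurable (Y x)) (hc : ∀ ω, Continuous fun x ↦ Y x ω) (ω : Ω) :
    Continuous fun x ↦ wickExp P Y x ω := by
  have := h.continuous_integral_sq hm hc
  have := hc ω
  unfold wickExp
  fun_prop

lemma measurable_wickExp (hm : ∀ x, Measurable (Y x)) (x : D) : Measurable (wickExp P Y x) := by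
  have := hm x
  unfold wickExp
  fun_prop

/-- The total mass of the chaos associated with `Y`. -/
noncomputable def chaos {mD : MeasurableSpace D} (P : Measure Ω) (Y : D → Ω → ℝ)
    (σ : Measure D) (ω : Ω) : ℝ :=
  ∫ x, wickExp P Y x ω ∂σ

lemma chaos_nonneg {mD : MeasurableSpace D} (σ : Measure D) (ω : Ω) : 0 ≤ chaos P Y σ ω :=
  integral_nonneg fun _ ↦ (wickExp_pos _ _).le

/-- A Gaussian process with almost surely continuous paths has a version all of whose paths are
continuous. -/
lemma IsCenteredGaussian.exists_continuous_version [TopologicalSpace D]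
    [MeasurableSpace D] (h : IsCenteredGaussian P Y) (hm : ∀ x, Measurable (Y x))
    (hc : ∀ᵐ ω ∂P, Continuous fun x ↦ Y x ω) :
    ∃ Y' : D → Ω → ℝ, IsCenteredGaussian P Y' ∧ (∀ x, Measurable (Y' x)) ∧
      (∀ ω, Continuous fun x ↦ Y' x ω) ∧
      (∀ x y, ∫ ω, Y' x ω * Y' y ω ∂P = ∫ ω, Y x ω * Y y ω ∂P) ∧
      ∀ (σ : Measure D) (F : ℝ → ℝ),
        ∫ ω, F (chaos P Y' σ ω) ∂P = ∫ ω, F (chaos P Y σ ω) ∂P := by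
  obtain ⟨t, ht, htm, ht0⟩ := exists_measurable_superset_of_null hc
  set Y' : D → Ω → ℝ := fun x ↦ tᶜ.indicator (Y x) with hY'
  have hae : ∀ᵐ ω ∂P, ∀ x, Y' x ω = Y x ω := by
    filter_upwards [compl_mem_ae_iff.2 ht0] with ω hω x
    exact Set.indicator_of_mem hω _
  refine ⟨Y', fun n x l ↦ ?_, fun x ↦ (hm x).indicator htm.compl, fun ω ↦ ?_, fun x y ↦ ?_,
    fun σ F ↦ ?_⟩
  · obtain ⟨v, hv⟩ := h n x l
    refine ⟨v, hv ▸ Measure.map_congr ?_⟩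
    filter_upwards [hae] with ω hω
    simp only [hω]
  · by_cases hω : ω ∈ t
    · simpa [hY', hω] using continuous_const
    · have : Continuous fun x ↦ Y x ω := by
        by_contra hcon
        exact hω (ht hcon)
      simpa [hY', hω] using this
  · refine integral_congr_ae ?_
    filter_upwards [hae] with ω hω
    simp only [hω]
  · have hsq : ∀ x, ∫ ω, Y' x ω ^ 2 ∂P = ∫ ω, Y x ω ^ 2 ∂P := fun x ↦ by
      refine integral_congr_ae ?_
      filter_upwards [hae] with ω hω
      simp only [hω]
    refine integral_congr_ae ?_
    filter_upwards [hae] with ω hω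
    simp only [chaos, wickExp, hsq, hω]

lemma IsCenteredGaussian.integral_comp_sum_wickExp [IsProbabilityMeasure P]
    (h : IsCenteredGaussian P Y) (hm : ∀ x, Measurable (Y x)) {F : ℝ → ℝ} (hF : Continuous F)
    {n : ℕ} (x : Fin n → D) (p : Fin n → ℝ) :
    ∫ ω, F (∑ k, p k * wickExp P Y (x k) ω) ∂P =
      ∫ z, F (wickSum p (covMatrix P Y x) z) ∂(multivariateGaussian 0 (covMatrix P Y x)) := by
  have hmeas : Measurable fun ω ↦ WithLp.toLp 2 fun i ↦ Y (x i) ω := by fun_prop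
  rw [← h.map_toLp hm x, integral_map hmeas.aemeasurable (by fun_prop)]
  simp [wickSum, wickExp, covMatrix, sq]

section Chaos

variable [MetricSpace D] [CompactSpace D] [MeasurableSpace D] [BorelSpace D]
  {P : Measure Ω} [IsProbabilityMeasure P] {Y : D → Ω → ℝ}

lemma IsCenteredGaussian.measurable_uncurry_wickExp (h : IsCenteredGaussian P Y)
    (hm : ∀ x, Measurable (Y x)) (hc : ∀ ω, Continuous fun x ↦ Y x ω) :
    Measurable (Function.uncurry (wickExp P Y)) :=
  measurable_uncurry_of_continuous_of_measurable (fun ω ↦ h.continuous_wickExp hm hc ω)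
    fun x ↦ measurable_wickExp hm x

variable (σ : Measure D) [IsFiniteMeasure σ]

lemma IsCenteredGaussian.integrable_wickExp_pow_prod (h : IsCenteredGaussian P Y)
    (hm : ∀ x, Measurable (Y x)) (hc : ∀ ω, Continuous fun x ↦ Y x ω) (n : ℕ) :
    Integrable (fun z : D × Ω ↦ wickExp P Y z.1 z.2 ^ n) (σ.prod P) := by
  have hmeas := (h.measurable_uncurry_wickExp hm hc).pow_const n
  refine (integrable_prod_iff hmeas.aestronglyMeasurable).2
    ⟨.of_forall fun x ↦ (h.wickExp_pow hm x n).1, ?_⟩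
  simp only [Function.uncurry, Real.norm_eq_abs, abs_of_pos (pow_pos (wickExp_pos _ _) n),
    (h.wickExp_pow hm _ n).2]
  have := h.continuous_integral_sq hm hc
  have hcont : Continuous fun x ↦
      Real.exp (((n : ℝ) ^ 2 - n) / 2 * ∫ ω, Y x ω ^ 2 ∂P) := by fun_prop
  exact hcont.integrable_of_hasCompactSupport (.of_compactSpace _)

lemma IsCenteredGaussian.measurable_chaos (h : IsCenteredGaussian P Y)
    (hm : ∀ x, Measurable (Y x)) (hc : ∀ ω, Continuous fun x ↦ Y x ω) :
    Measurable (chaos P Y σ) :=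
  ((h.measurable_uncurry_wickExp hm hc).comp measurable_swap).stronglyMeasurable.integral_prod_right'
    |>.measurable

lemma IsCenteredGaussian.integrable_wickExp_path (h : IsCenteredGaussian P Y)
    (hm : ∀ x, Measurable (Y x)) (hc : ∀ ω, Continuous fun x ↦ Y x ω) (n : ℕ) (ω : Ω) :
    Integrable (fun x ↦ wickExp P Y x ω ^ n) σ :=
  ((h.continuous_wickExp hm hc ω).pow n).integrable_of_hasCompactSupport (.of_compactSpace _)

lemma IsCenteredGaussian.chaos_pos (h : IsCenteredGaussian P Y)
    (hm : ∀ x, Measurable (Y x)) (hc : ∀ ω, Continuous fun x ↦ Y x ω) (hσ : σ ≠ 0) (ω : Ω) :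
    0 < chaos P Y σ ω := by
  have hi := h.integrable_wickExp_path σ hm hc 1 ω
  simp only [pow_one] at hi
  refine (integral_pos_iff_support_of_nonneg (fun _ ↦ (wickExp_pos _ _).le) hi).2 ?_
  have : Function.support (fun x ↦ wickExp P Y x ω) = Set.univ :=
    Function.support_eq_univ fun x ↦ (wickExp_pos x ω).ne'
  rw [this]
  simpa [pos_iff_ne_zero] using hσ

lemma IsCenteredGaussian.integrable_chaos_pow (h : IsCenteredGaussian P Y)
    (hm : ∀ x, Measurable (Y x)) (hc : ∀ ω, Continuous fun x ↦ Y x ω) (n : ℕ) :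
    Integrable (fun ω ↦ chaos P Y σ ω ^ n) P := by
  rcases eq_or_ne σ 0 with rfl | hσ
  · simp [chaos]
  have : NeZero σ := ⟨hσ⟩
  have hI : Integrable (fun ω ↦ σ.real Set.univ ^ n * ⨍ x, wickExp P Y x ω ^ n ∂σ) P := by
    simp only [average_eq]
    exact ((h.integrable_wickExp_pow_prod σ hm hc n).integral_prod_right.const_mul _).const_mul _
  refine hI.mono' ((h.measurable_chaos σ hm hc).pow_const n).aestronglyMeasurable
    (.of_forall fun ω ↦ ?_)
  rw [Real.norm_eq_abs, abs_of_nonneg (pow_nonneg (chaos_nonneg σ ω) n)]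
  have hJ := (convexOn_pow n).map_average_le (μ := σ) (f := fun x ↦ wickExp P Y x ω)
    (by fun_prop) isClosed_Ici (.of_forall fun x ↦ (wickExp_pos x ω).le)
    (by simpa using h.integrable_wickExp_path σ hm hc 1 ω)
    (h.integrable_wickExp_path σ hm hc n ω)
  have hσ0 : 0 < σ.real Set.univ := by simpa [measureReal_def, ENNReal.toReal_pos_iff] using hσ
  have e : chaos P Y σ ω = σ.real Set.univ * ⨍ x, wickExp P Y x ω ∂σ := by
    rw [average_eq, smul_eq_mul, mul_inv_cancel_left₀ hσ0.ne', chaos]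
  rw [e, mul_pow]
  gcongr

lemma IsCenteredGaussian.integral_chaos (h : IsCenteredGaussian P Y)
    (hm : ∀ x, Measurable (Y x)) (hc : ∀ ω, Continuous fun x ↦ Y x ω) :
    ∫ ω, chaos P Y σ ω ∂P = σ.real Set.univ := by
  have := h.integrable_wickExp_pow_prod σ hm hc 1
  simp only [pow_one] at this
  unfold chaos
  rw [← integral_integral_swap (f := fun x ω ↦ wickExp P Y x ω) this]
  simp [h.integral_wickExp hm]

lemma IsCenteredGaussian.tendsto_integral_comp_discretization [Nonempty D]
    (h : IsCenteredGaussian P Y) (hm : ∀ x, Measurable (Y x))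
    (hc : ∀ ω, Continuous fun x ↦ Y x ω) {F : ℝ → ℝ} {K : ℝ≥0} (hK : LipschitzWith K F) :
    Tendsto (fun N ↦ ∫ ω, F (∑ k : Fin (N + 1),
      σ.real (SimpleFunc.nearestPtInd (TopologicalSpace.denseSeq D) N ⁻¹' {(k : ℕ)}) *
        wickExp P Y (TopologicalSpace.denseSeq D k) ω) ∂P)
      atTop (𝓝 (∫ ω, F (chaos P Y σ ω) ∂P)) := by
  set e := TopologicalSpace.denseSeq D with he
  set M : ℕ → Ω → ℝ := fun N ω ↦ ∑ k : Fin (N + 1),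
    σ.real (SimpleFunc.nearestPtInd e N ⁻¹' {(k : ℕ)}) * wickExp P Y (e k) ω with hM
  have hMeq : ∀ N ω, M N ω = ∫ x, wickExp P Y (SimpleFunc.nearestPt e N x) ω ∂σ := fun N ω ↦
    (integral_comp_simpleFunc_nat σ _ (SimpleFunc.nearestPtInd_le e N)
      fun k ↦ wickExp P Y (e k) ω).symm
  have hwi : ∀ x, Integrable (wickExp P Y x) P := fun x ↦ by
    simpa using (h.wickExp_pow hm x 1).1
  have hMi : ∀ N, Integrable (M N) P := fun N ↦
    integrable_finsetSum _ fun k _ ↦ (hwi _).const_mul _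
  have hci : Integrable (chaos P Y σ) P := by simpa using h.integrable_chaos_pow σ hm hc 1
  have hlim : ∀ ω, Tendsto (fun N ↦ M N ω) atTop (𝓝 (chaos P Y σ ω)) := by
    intro ω
    have hcont := h.continuous_wickExp hm hc ω
    obtain ⟨C, hC⟩ := (isCompact_range hcont).bddAbove
    simp only [hMeq]
    refine tendsto_integral_of_dominated_convergence (fun _ ↦ C) (fun N ↦ ?_)
      (integrable_const C) (fun N ↦ .of_forall fun x ↦ ?_) (.of_forall fun x ↦ ?_)
    · exact (hcont.measurable.comp (SimpleFunc.measurable _)).aestronglyMeasurable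
    · rw [Real.norm_eq_abs, abs_of_pos (wickExp_pos _ _)]
      exact hC (Set.mem_range_self _)
    · exact (hcont.tendsto x).comp (SimpleFunc.tendsto_nearestPt
        (by rw [(TopologicalSpace.denseRange_denseSeq D).closure_range]; trivial))
  have hI : ∀ N, ∫ ω, M N ω ∂P = ∫ ω, chaos P Y σ ω ∂P := by
    intro N
    rw [h.integral_chaos σ hm hc, integral_finsetSum _ fun k _ ↦ (hwi _).const_mul _]
    simp only [integral_const_mul, h.integral_wickExp hm]
    have := integral_comp_simpleFunc_nat σ _ (SimpleFunc.nearestPtInd_le e N) fun _ ↦ 1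
    simpa using this.symm
  have hS := tendsto_integral_abs_sub_of_tendsto hMi hci
    (fun N ω ↦ Finset.sum_nonneg fun k _ ↦ mul_nonneg measureReal_nonneg (wickExp_pos _ _).le)
    (chaos_nonneg σ) hlim hI
  rw [tendsto_iff_dist_tendsto_zero]
  refine squeeze_zero (fun _ ↦ dist_nonneg) (fun N ↦ ?_)
    (by simpa using hS.const_mul (K : ℝ))
  rw [Real.dist_eq, ← integral_sub (hK.integrable_comp (hMi N)) (hK.integrable_comp hci),
    ← integral_const_mul, ← Real.norm_eq_abs]
  refine norm_integral_le_of_norm_le (((hMi N).sub' hci).abs.const_mul _) (.of_forall fun ω ↦ ?_)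
  simpa [Real.dist_eq] using hK.dist_le_mul (M N ω) (chaos P Y σ ω)

/-- Kahane's inequality for continuous processes and Lipschitz convex functions. -/
lemma integral_comp_chaos_le_of_lipschitz {Ω' : Type*} {mΩ' : MeasurableSpace Ω'}
    {P' : Measure Ω'} [IsProbabilityMeasure P'] {Z : D → Ω' → ℝ}
    (hY : IsCenteredGaussian P Y) (hYm : ∀ x, Measurable (Y x))
    (hYc : ∀ ω, Continuous fun x ↦ Y x ω)
    (hZ : IsCenteredGaussian P' Z) (hZm : ∀ x, Measurable (Z x))
    (hZc : ∀ ω, Continuous fun x ↦ Z x ω)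
    (hcov : ∀ x y, ∫ ω, Y x ω * Y y ω ∂P ≤ ∫ ω, Z x ω * Z y ω ∂P')
    {F : ℝ → ℝ} (hF : ConvexOn ℝ Set.univ F) {K : ℝ≥0} (hK : LipschitzWith K F) :
    ∫ ω, F (chaos P Y σ ω) ∂P ≤ ∫ ω, F (chaos P' Z σ ω) ∂P' := by
  rcases isEmpty_or_nonempty D with hD | hD
  · simp [chaos, σ.eq_zero_of_isEmpty]
  refine le_of_tendsto_of_tendsto' (hY.tendsto_integral_comp_discretization σ hYm hYc hK)
    (hZ.tendsto_integral_comp_discretization σ hZm hZc hK) fun N ↦ ?_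
  rw [hY.integral_comp_sum_wickExp hYm hK.continuous (fun k ↦ TopologicalSpace.denseSeq D k),
    hZ.integral_comp_sum_wickExp hZm hK.continuous (fun k ↦ TopologicalSpace.denseSeq D k)]
  exact integral_comp_wickSum_le_of_lipschitz hF hK (hY.posSemidef_covMatrix hYm _)
    (hZ.posSemidef_covMatrix hZm _) (fun i j ↦ hcov _ _) fun _ ↦ measureReal_nonneg

lemma IsCenteredGaussian.integrable_comp_chaos (h : IsCenteredGaussian P Y)
    (hm : ∀ x, Measurable (Y x)) (hc : ∀ ω, Continuous fun x ↦ Y x ω) {F : ℝ → ℝ} {C : ℝ} {N : ℕ}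
    (hgrowth : ∀ t, 0 ≤ t → |F t| ≤ C * (1 + t) ^ N)
    (hF : AEStronglyMeasurable (fun ω ↦ F (chaos P Y σ ω)) P) :
    Integrable (fun ω ↦ F (chaos P Y σ ω)) P := by
  have hC : 0 ≤ C := by simpa using (abs_nonneg _).trans (hgrowth 0 le_rfl)
  refine (((integrable_const (1 : ℝ)).fun_add (h.integrable_chaos_pow σ hm hc N)).const_mul
    (C * 2 ^ (N - 1))).mono' hF (.of_forall fun ω ↦ (hgrowth _ (chaos_nonneg σ ω)).trans ?_)
  have := add_pow_le zero_le_one (chaos_nonneg (P := P) (Y := Y) σ ω) N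
  rw [one_pow] at this
  rw [mul_assoc]
  gcongr

lemma IsCenteredGaussian.tendsto_integral_comp_chaos (h : IsCenteredGaussian P Y)
    (hm : ∀ x, Measurable (Y x)) (hc : ∀ ω, Continuous fun x ↦ Y x ω) (hσ : σ ≠ 0) {F : ℝ → ℝ}
    (hgrowth : ∃ (C : ℝ) (N : ℕ), ∀ t, 0 ≤ t → |F t| ≤ C * (1 + t) ^ N)
    {G : ℕ → ℝ → ℝ} (hG : ∀ n, ∃ K : ℝ≥0, LipschitzWith K (G n)) (hGm : Monotone G)
    (hGF : ∀ n t, 0 ≤ t → G n t ≤ F t)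
    (hlim : ∀ t, 0 < t → Tendsto (fun n ↦ G n t) atTop (𝓝 (F t))) :
    Tendsto (fun n ↦ ∫ ω, G n (chaos P Y σ ω) ∂P) atTop (𝓝 (∫ ω, F (chaos P Y σ ω) ∂P)) := by
  obtain ⟨C, N, hCN⟩ := hgrowth
  have hci : Integrable (chaos P Y σ) P := by simpa using h.integrable_chaos_pow σ hm hc 1
  have hGi : ∀ n, Integrable (fun ω ↦ G n (chaos P Y σ ω)) P := fun n ↦
    (hG n).choose_spec.integrable_comp hci
  have hl : ∀ ω, Tendsto (fun n ↦ G n (chaos P Y σ ω)) atTop (𝓝 (F (chaos P Y σ ω))) := fun ω ↦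
    hlim _ (h.chaos_pos σ hm hc hσ ω)
  have hFi := h.integrable_comp_chaos σ hm hc hCN
    (aestronglyMeasurable_of_tendsto_ae atTop (fun n ↦ (hGi n).1) (.of_forall hl))
  refine tendsto_integral_of_dominated_convergence _ (fun n ↦ (hGi n).1)
    ((hGi 0).abs.fun_add hFi.abs) (fun n ↦ .of_forall fun ω ↦ ?_) (.of_forall hl)
  rw [Real.norm_eq_abs, abs_le]
  have h1 := hGm (Nat.zero_le n) (chaos P Y σ ω)
  have h2 := hGF n _ (chaos_nonneg (P := P) (Y := Y) σ ω)
  constructor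
  · linarith [neg_abs_le (G 0 (chaos P Y σ ω)), abs_nonneg (F (chaos P Y σ ω))]
  · linarith [le_abs_self (F (chaos P Y σ ω)), abs_nonneg (G 0 (chaos P Y σ ω))]

/-- Kahane's inequality for processes all of whose paths are continuous. -/
lemma integral_comp_chaos_le {Ω' : Type*} {mΩ' : MeasurableSpace Ω'}
    {P' : Measure Ω'} [IsProbabilityMeasure P'] {Z : D → Ω' → ℝ}
    (hY : IsCenteredGaussian P Y) (hYm : ∀ x, Measurable (Y x))
    (hYc : ∀ ω, Continuous fun x ↦ Y x ω)
    (hZ : IsCenteredGaussian P' Z) (hZm : ∀ x, Measurable (Z x))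
    (hZc : ∀ ω, Continuous fun x ↦ Z x ω)
    (hcov : ∀ x y, ∫ ω, Y x ω * Y y ω ∂P ≤ ∫ ω, Z x ω * Z y ω ∂P')
    {F : ℝ → ℝ} (hF : ConvexOn ℝ (Set.Ici 0) F)
    (hgrowth : ∃ (C : ℝ) (N : ℕ), ∀ t, 0 ≤ t → |F t| ≤ C * (1 + t) ^ N) :
    ∫ ω, F (chaos P Y σ ω) ∂P ≤ ∫ ω, F (chaos P' Z σ ω) ∂P' := by
  rcases eq_or_ne σ 0 with rfl | hσ
  · simp [chaos]
  obtain ⟨G, hGc, hGl, hGm, hGF, hlim⟩ := exists_lipschitz_convex_approx hF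
  refine le_of_tendsto_of_tendsto'
    (hY.tendsto_integral_comp_chaos σ hYm hYc hσ hgrowth hGl hGm hGF hlim)
    (hZ.tendsto_integral_comp_chaos σ hZm hZc hσ hgrowth hGl hGm hGF hlim) fun n ↦ ?_
  exact integral_comp_chaos_le_of_lipschitz σ hY hYm hYc hZ hZm hZc hcov (hGc n)
    (hGl n).choose_spec

end Chaos

end GaussianFamily

end Kahane

/-- **Kahane's convexity inequality.** Let `D` be a compact metric space, `σ` a finite Borel
measure on `D`, and let `(Y(x))_{x∈D}`, `(Z(x))_{x∈D}` be centered Gaussian processes (on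
probability spaces `Ω₁`, `Ω₂`) with almost surely continuous sample paths, with
`E[Y(x)Y(y)] ≤ E[Z(x)Z(y)]` for all `x, y`. Then for every convex `F : [0,∞) → ℝ` of at most
polynomial growth, `E[F(∫ e^{Y(x) - E[Y(x)²]/2} σ(dx))] ≤ E[F(∫ e^{Z(x) - E[Z(x)²]/2} σ(dx))]`,
and the reverse inequality holds when `F` is concave of at most polynomial growth. -/
theorem kahane_convexity_inequality
    {D : Type*} [MetricSpace D] [CompactSpace D] [MeasurableSpace D] [BorelSpace D]
    (σ : Measure D) [IsFiniteMeasure σ]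
    {Ω₁ Ω₂ : Type*} [MeasurableSpace Ω₁] [MeasurableSpace Ω₂]
    (P₁ : Measure Ω₁) (P₂ : Measure Ω₂) [IsProbabilityMeasure P₁] [IsProbabilityMeasure P₂]
    (Y : D → Ω₁ → ℝ) (Z : D → Ω₂ → ℝ)
    (hYmeas : ∀ x, Measurable (Y x)) (hZmeas : ∀ x, Measurable (Z x))
    (hYgauss : ∀ (n : ℕ) (x : Fin n → D) (l : Fin n → ℝ), ∃ v : ℝ≥0,
      Measure.map (fun ω => ∑ i, l i * Y (x i) ω) P₁ = gaussianReal 0 v)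
    (hZgauss : ∀ (n : ℕ) (x : Fin n → D) (l : Fin n → ℝ), ∃ v : ℝ≥0,
      Measure.map (fun ω => ∑ i, l i * Z (x i) ω) P₂ = gaussianReal 0 v)
    (hYcont : ∀ᵐ ω ∂P₁, Continuous fun x => Y x ω)
    (hZcont : ∀ᵐ ω ∂P₂, Continuous fun x => Z x ω)
    (hcov : ∀ x y, (∫ ω, Y x ω * Y y ω ∂P₁) ≤ ∫ ω, Z x ω * Z y ω ∂P₂)
    (F : ℝ → ℝ) (hgrowth : ∃ (C : ℝ) (N : ℕ), ∀ t : ℝ, 0 ≤ t → |F t| ≤ C * (1 + t) ^ N) :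
    (ConvexOn ℝ (Set.Ici (0 : ℝ)) F →
      (∫ ω, F (∫ x, Real.exp (Y x ω - (∫ ω', (Y x ω') ^ 2 ∂P₁) / 2) ∂σ) ∂P₁) ≤
        ∫ ω, F (∫ x, Real.exp (Z x ω - (∫ ω', (Z x ω') ^ 2 ∂P₂) / 2) ∂σ) ∂P₂) ∧
    (ConcaveOn ℝ (Set.Ici (0 : ℝ)) F →
      (∫ ω, F (∫ x, Real.exp (Z x ω - (∫ ω', (Z x ω') ^ 2 ∂P₂) / 2) ∂σ) ∂P₂) ≤
        ∫ ω, F (∫ x, Real.exp (Y x ω - (∫ ω', (Y x ω') ^ 2 ∂P₁) / 2) ∂σ) ∂P₁) := by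
  obtain ⟨Y', hY, hYm, hYc, hYcov, hYF⟩ :=
    Kahane.IsCenteredGaussian.exists_continuous_version hYgauss hYmeas hYcont
  obtain ⟨Z', hZ, hZm, hZc, hZcov, hZF⟩ :=
    Kahane.IsCenteredGaussian.exists_continuous_version hZgauss hZmeas hZcont
  have key : ∀ G : ℝ → ℝ, ConvexOn ℝ (Set.Ici 0) G →
      (∃ (C : ℝ) (N : ℕ), ∀ t, 0 ≤ t → |G t| ≤ C * (1 + t) ^ N) →
      ∫ ω, G (Kahane.chaos P₁ Y σ ω) ∂P₁ ≤ ∫ ω, G (Kahane.chaos P₂ Z σ ω) ∂P₂ := by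
    intro G hG hGgrowth
    rw [← hYF, ← hZF]
    exact Kahane.integral_comp_chaos_le σ hY hYm hYc hZ hZm hZc
      (fun x y ↦ by rw [hYcov, hZcov]; exact hcov x y) hG hGgrowth
  refine ⟨fun hF ↦ key F hF hgrowth, fun hF ↦ ?_⟩
  have := key (-F) hF.neg (by simpa using hgrowth)
  simp only [Pi.neg_apply, integral_neg, neg_le_neg_iff] at this
  exact this
end
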